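/- arXiv:1310.7615 — 7 statements merged into one kernel-verified Lean document; each statement's English description precedes it below -/
import Mathlib

section
/- Assume the reduced interaction matrix J = (J11, J12; J12, J22) with J11 > 0, J22 > 0 is positive definite. Let m = inf{G̃(x) : x ∈ ℝ²} and let V be any closed (possibly unbounded) subset of ℝ² containing no global minimum point of G̃. Then there exists ε > 0 such that e^{Nm} ∫_V exp(−N·G̃(x)) dx = O(e^{−Nε}) as N → ∞. -/
noncomputable section
open Real MeasureTheory Matrix Filter Asymptotics

/-- The pressure functional `G` of the bipartite mean-field model. -/
def presG (α J11 J12 J22 x1 x2 : ℝ) : ℝ :=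
  (1/2) * (α^2 * J11 * x1^2 + 2 * α * (1-α) * J12 * x1 * x2 + (1-α)^2 * J22 * x2^2)
    - α * Real.log (Real.cosh (α * J11 * x1 + (1-α) * J12 * x2))
    - (1-α) * Real.log (Real.cosh (α * J12 * x1 + (1-α) * J22 * x2))

/-- The reduced interaction matrix. -/
def Jmat (J11 J12 J22 : ℝ) : Matrix (Fin 2) (Fin 2) ℝ := !![J11, J12; J12, J22]

/-- `G̃(x) = G(P⁻¹x)` for an orthogonal matrix `P`. -/
def GtilP (α J11 J12 J22 : ℝ) (P : Matrix (Fin 2) (Fin 2) ℝ) (x : ℝ × ℝ) : ℝ :=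
  presG α J11 J12 J22 (P⁻¹.mulVec ![x.1, x.2] 0) (P⁻¹.mulVec ![x.1, x.2] 1)

lemma log_cosh_le_abs_aux (t : ℝ) : Real.log (Real.cosh t) ≤ |t| := by
  rw [Real.log_le_iff_le_exp (Real.cosh_pos t), ← Real.cosh_abs t]
  have h1 := Real.cosh_add_sinh |t|
  have h2 : 0 ≤ Real.sinh |t| := Real.sinh_nonneg_iff.2 (abs_nonneg t)
  linarith

lemma presG_lower (α J11 J12 J22 : ℝ) (hα0 : 0 < α) (hα1 : α < 1)
    (hJ11 : 0 < J11) (hJ22 : 0 < J22) (hD : 0 < J11 * J22 - J12 * J12) :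
    ∃ c > 0, ∃ C, ∀ y1 y2 : ℝ, c * (y1^2 + y2^2) - C ≤ presG α J11 J12 J22 y1 y2 := by
  have hT : 0 < J11 + J22 := by positivity
  have hβ : 0 < α * (1 - α) := mul_pos hα0 (by linarith)
  refine ⟨(J11 * J22 - J12 * J12) / (4 * (J11 + J22)) * (α * (1 - α))^2, by positivity,
    2 * (J11 + J22), fun y1 y2 => ?_⟩
  unfold presG
  obtain ⟨u, hu⟩ : ∃ u, u = α * y1 := ⟨_, rfl⟩
  obtain ⟨v, hv⟩ : ∃ v, v = (1 - α) * y2 := ⟨_, rfl⟩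
  obtain ⟨s, hs⟩ : ∃ s, s = J11 * u + J12 * v := ⟨_, rfl⟩
  obtain ⟨t, ht⟩ : ∃ t, t = J12 * u + J22 * v := ⟨_, rfl⟩
  obtain ⟨T, hTT⟩ : ∃ T, T = J11 + J22 := ⟨_, rfl⟩
  obtain ⟨D, hDD⟩ : ∃ D, D = J11 * J22 - J12 * J12 := ⟨_, rfl⟩
  obtain ⟨Q, hQ⟩ : ∃ Q, Q = J11 * u^2 + 2 * J12 * u * v + J22 * v^2 := ⟨_, rfl⟩
  have e1 : α * J11 * y1 + (1-α) * J12 * y2 = s := by rw [hs, hu, hv]; ring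
  have e2 : α * J12 * y1 + (1-α) * J22 * y2 = t := by rw [ht, hu, hv]; ring
  have e3 : α^2 * J11 * y1^2 + 2 * α * (1-α) * J12 * y1 * y2 + (1-α)^2 * J22 * y2^2 = Q := by
    rw [hQ, hu, hv]; ring
  have e4 : s^2 + t^2 = T * Q - D * (u^2 + v^2) := by
    rw [hs, ht, hTT, hDD, hQ]; ring
  rw [e1, e2, e3, ← hTT, ← hDD]
  rw [← hTT] at hT
  rw [← hDD] at hD
  have hls : α * Real.log (Real.cosh s) ≤ |s| := by
    have h0 := Real.log_nonneg (Real.one_le_cosh s)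
    have := log_cosh_le_abs_aux s
    exact (mul_le_of_le_one_left h0 hα1.le).trans this
  have hlt : (1 - α) * Real.log (Real.cosh t) ≤ |t| := by
    have h0 := Real.log_nonneg (Real.one_le_cosh t)
    have := log_cosh_le_abs_aux t
    exact (mul_le_of_le_one_left h0 (by linarith)).trans this
  have amgm : ∀ r : ℝ, |r| ≤ r^2 / (4 * T) + T := by
    intro r
    have : r^2 / (4 * T) + T - |r| = (|r| - 2 * T)^2 / (4 * T) := by
      rw [← sq_abs r]; field_simp; ring
    have h2 : 0 ≤ (|r| - 2 * T)^2 / (4 * T) := by positivity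
    linarith
  have hs' := amgm s
  have ht' := amgm t
  have e5 : s^2 / (4 * T) + t^2 / (4 * T) = Q / 4 - D / (4 * T) * (u^2+v^2) := by
    rw [← add_div, e4]; field_simp
  have hk : 0 < D / (4 * T) := by positivity
  have hQ0 : 0 ≤ Q := by
    have : 0 ≤ T * Q := by
      have : T * Q = s^2 + t^2 + D * (u^2 + v^2) := by linarith
      rw [this]; positivity
    exact nonneg_of_mul_nonneg_right this hT
  have huv : (α * (1 - α))^2 * (y1^2 + y2^2) ≤ u^2 + v^2 := by
    have a1 : (1-α)^2 ≤ 1 := pow_le_one₀ (by linarith) (by linarith)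
    have a2 : α^2 ≤ 1 := pow_le_one₀ (by linarith) (by linarith)
    have b1 : (α * y1)^2 * (1-α)^2 ≤ (α * y1)^2 * 1 := by gcongr
    have b2 : ((1-α) * y2)^2 * α^2 ≤ ((1-α) * y2)^2 * 1 := by gcongr
    rw [hu, hv]; linarith
  have := mul_le_mul_of_nonneg_left huv hk.le
  rw [mul_assoc]
  linarith

lemma GtilP_lower (α J11 J12 J22 : ℝ) (hα0 : 0 < α) (hα1 : α < 1)
    (hJ11 : 0 < J11) (hJ22 : 0 < J22)
    (hpd : (Jmat J11 J12 J22).PosDef)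
    (P : Matrix (Fin 2) (Fin 2) ℝ) (hP : P ∈ Matrix.orthogonalGroup (Fin 2) ℝ) :
    ∃ c > 0, ∃ C, ∀ x : ℝ × ℝ, c * (x.1^2 + x.2^2) - C ≤ GtilP α J11 J12 J22 P x := by
  have hD : 0 < J11 * J22 - J12 * J12 := by
    have := hpd.det_pos
    simpa [Jmat, Matrix.det_fin_two] using this
  obtain ⟨c, hc, C, h⟩ := presG_lower α J11 J12 J22 hα0 hα1 hJ11 hJ22 hD
  refine ⟨c, hc, C, fun x => ?_⟩
  have h1 : P * Pᵀ = 1 := Matrix.mem_orthogonalGroup_iff _ _ |>.1 hP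
  have hinv : P⁻¹ = Pᵀ := Matrix.inv_eq_right_inv h1
  have := h (P⁻¹.mulVec ![x.1, x.2] 0) (P⁻¹.mulVec ![x.1, x.2] 1)
  have e : (P⁻¹.mulVec ![x.1, x.2] 0)^2 + (P⁻¹.mulVec ![x.1, x.2] 1)^2 = x.1^2 + x.2^2 := by
    have h00 := congrFun (congrFun h1 0) 0
    have h01 := congrFun (congrFun h1 0) 1
    have h11 := congrFun (congrFun h1 1) 1
    simp [Matrix.mul_apply, Fin.sum_univ_two] at h00 h01 h11
    rw [hinv]
    simp [Matrix.mulVec, dotProduct, Fin.sum_univ_two]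
    linear_combination x.1^2 * h00 + 2 * x.1 * x.2 * h01 + x.2^2 * h11
  rw [e] at this
  exact this

lemma GtilP_cont (α J11 J12 J22 : ℝ) (P : Matrix (Fin 2) (Fin 2) ℝ) :
    Continuous (GtilP α J11 J12 J22 P) := by
  unfold GtilP presG
  have hl : ∀ f : ℝ × ℝ → ℝ, Continuous f → Continuous fun x => Real.log (Real.cosh (f x)) :=
    fun f hf => (Real.continuous_cosh.comp hf).log fun x => (Real.cosh_pos _).ne'
  simp only [Matrix.mulVec, dotProduct, Fin.sum_univ_two, Matrix.cons_val_zero, Matrix.cons_val_one]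
  refine Continuous.sub (Continuous.sub (by fun_prop) (continuous_const.mul (hl _ (by fun_prop))))
    (continuous_const.mul (hl _ (by fun_prop)))

/-- Laplace-type estimate: if `V` is a closed subset of `ℝ²` containing no global
minimum point of `G̃`, then `e^{Nm} ∫_V exp(-N G̃(x)) dx = O(e^{-Nε})` as `N → ∞`,
where `m = inf G̃`. -/
theorem laplace_estimate_away_from_minima
    (α J11 J12 J22 : ℝ) (hα0 : 0 < α) (hα1 : α < 1)
    (hJ11 : 0 < J11) (hJ22 : 0 < J22)
    (hpd : (Jmat J11 J12 J22).PosDef)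
    (P : Matrix (Fin 2) (Fin 2) ℝ) (hP : P ∈ Matrix.orthogonalGroup (Fin 2) ℝ)
    (m : ℝ) (hm : m = ⨅ x : ℝ × ℝ, GtilP α J11 J12 J22 P x)
    (V : Set (ℝ × ℝ)) (hV : IsClosed V)
    (hVmin : ∀ x ∈ V, ¬ IsMinOn (GtilP α J11 J12 J22 P) Set.univ x) :
    ∃ ε > 0,
      (fun N : ℕ => Real.exp (N * m) *
          ∫ x in V, Real.exp (-(N : ℝ) * GtilP α J11 J12 J22 P x))
        =O[atTop] fun N : ℕ => Real.exp (-(N : ℝ) * ε) := by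
  obtain ⟨c, hc, C, hlow⟩ := GtilP_lower α J11 J12 J22 hα0 hα1 hJ11 hJ22 hpd P hP
  have hcont := GtilP_cont α J11 J12 J22 P
  set F := GtilP α J11 J12 J22 P with hF
  have hbdd : BddBelow (Set.range F) := by
    refine ⟨-C, ?_⟩
    rintro _ ⟨x, rfl⟩
    have := hlow x
    have h2 : 0 ≤ c * (x.1^2 + x.2^2) := by positivity
    linarith
  have hmle : ∀ x, m ≤ F x := fun x => hm ▸ ciInf_le hbdd x
  have htend : Tendsto F (cocompact (ℝ × ℝ)) atTop := by
    have h1 : Tendsto (fun x : ℝ × ℝ => c * ‖x‖^2 - C) (cocompact (ℝ × ℝ)) atTop := by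
      refine tendsto_atTop_add_const_right _ _ ?_
      exact ((tendsto_pow_atTop two_ne_zero).comp (tendsto_norm_cocompact_atTop)).const_mul_atTop hc
    refine tendsto_atTop_mono (fun x => le_trans ?_ (hlow x)) h1
    have : ‖x‖^2 ≤ x.1^2 + x.2^2 := by
      rw [Prod.norm_def]
      rcases max_choice ‖x.1‖ ‖x.2‖ with h | h <;> rw [h, Real.norm_eq_abs, sq_abs] <;>
        nlinarith [sq_nonneg x.1, sq_nonneg x.2]
    have := mul_le_mul_of_nonneg_left this hc.le
    linarith
  have hint : Integrable (fun x => Real.exp (-F x)) := by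
    have hg := integrable_exp_neg_mul_sq hc
    have hg2 := (hg.mul_prod hg).const_mul (Real.exp C)
    refine Integrable.mono' hg2 (by fun_prop) (Eventually.of_forall fun x => ?_)
    rw [Real.norm_eq_abs, abs_of_pos (Real.exp_pos _), ← Real.exp_add, ← Real.exp_add]
    apply Real.exp_le_exp.2
    have := hlow x
    linarith
  obtain ⟨ε, hε, hVε⟩ : ∃ ε > 0, ∀ x ∈ V, m + ε ≤ F x := by
    rcases V.eq_empty_or_nonempty with rfl | ⟨z, hz⟩
    · exact ⟨1, one_pos, by simp⟩
    · obtain ⟨x0, hx0, hmin⟩ := hcont.continuousOn.exists_isMinOn' hV hz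
        ((htend.eventually_ge_atTop (F z)).filter_mono inf_le_left)
      have := hVmin x0 hx0
      rw [isMinOn_iff] at this
      push Not at this
      obtain ⟨y, -, hy⟩ := this
      refine ⟨F x0 - m, by linarith [hmle y], fun x hx => ?_⟩
      have := isMinOn_iff.1 hmin x hx
      linarith
  refine ⟨ε, hε, ?_⟩
  refine IsBigO.of_bound (Real.exp (ε + m) * ∫ x in V, Real.exp (-F x)) ?_
  filter_upwards [eventually_ge_atTop 1] with N hN
  have hN' : (1:ℝ) ≤ N := by exact_mod_cast hN
  rw [Real.norm_eq_abs, Real.norm_eq_abs, abs_of_pos (Real.exp_pos _),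
    abs_of_nonneg (mul_nonneg (Real.exp_pos _).le (integral_nonneg fun x => (Real.exp_pos _).le)),
    ← integral_const_mul, ← integral_const_mul, ← integral_mul_const]
  refine integral_mono_of_nonneg (Eventually.of_forall fun x => by positivity)
    ((hint.integrableOn.const_mul _).mul_const _) ?_
  filter_upwards [ae_restrict_mem hV.measurableSet] with x hx
  rw [← Real.exp_add, ← Real.exp_add, ← Real.exp_add]
  apply Real.exp_le_exp.2
  nlinarith [hVε x hx, mul_nonneg (sub_nonneg.2 hN') (sub_nonneg.2 (hVε x hx))]

end
end

section
/- Let α ∈ (0,1) and let J11, J22 > 0, J12 ≠ 0 satisfy J11 < 1/α, J22 < 1/(1−α), and (1−αJ11)(1−(1−α)J22) ≥ α(1−α)J12². Then (x1, x2) = (0, 0) is the unique solution in ℝ² of the system of mean-field equations x1 = tanh(αJ11·x1 + (1−α)J12·x2), x2 = tanh(αJ12·x1 + (1−α)J22·x2). -/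
noncomputable section
open Real

theorem aux_sinh_lt (y : ℝ) (hy : 0 < y) : Real.sinh y < y * Real.cosh y := by
  have hm : StrictMonoOn (fun t : ℝ => t * Real.cosh t - Real.sinh t) (Set.Ici 0) := by
    apply strictMonoOn_of_deriv_pos (convex_Ici 0)
    · fun_prop
    · intro t ht
      rw [interior_Ici] at ht
      have hd : HasDerivAt (fun t : ℝ => t * Real.cosh t - Real.sinh t)
          (1 * Real.cosh t + t * Real.sinh t - Real.cosh t) t :=
        ((hasDerivAt_id t).mul (Real.hasDerivAt_cosh t)).sub (Real.hasDerivAt_sinh t)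
      rw [hd.deriv]
      have h0 : 0 < t := ht
      have := mul_pos h0 (Real.sinh_pos_iff.2 h0)
      linarith
  have h := hm (Set.mem_Ici.2 le_rfl) (Set.mem_Ici.2 hy.le) hy
  simp at h
  linarith

theorem aux_tanh_pos (y : ℝ) (hy : 0 < y) : Real.tanh y ^ 2 < y * Real.tanh y := by
  have hc := Real.cosh_pos y
  have hp : 0 < Real.tanh y := by
    rw [Real.tanh_eq_sinh_div_cosh]
    exact div_pos (Real.sinh_pos_iff.2 hy) hc
  have hl : Real.tanh y < y := by
    rw [Real.tanh_eq_sinh_div_cosh, div_lt_iff₀ hc]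
    exact aux_sinh_lt y hy
  nlinarith

theorem aux_tanh (y : ℝ) (hy : y ≠ 0) : Real.tanh y ^ 2 < y * Real.tanh y := by
  rcases lt_or_gt_of_ne hy with h | h
  · have := aux_tanh_pos (-y) (by linarith)
    rw [Real.tanh_neg] at this
    linarith [neg_sq (Real.tanh y), neg_mul_neg y (Real.tanh y)]
  · exact aux_tanh_pos y h

theorem aux_tanh_le (y : ℝ) : Real.tanh y ^ 2 ≤ y * Real.tanh y := by
  by_cases hy : y = 0
  · simp [hy]
  · exact (aux_tanh y hy).le

/-- The origin is the unique solution of the mean-field equations of the bipartite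
mean-field model when `J11 < 1/α`, `J22 < 1/(1-α)` and
`(1-αJ11)(1-(1-α)J22) ≥ α(1-α)J12²`. -/
theorem unique_solution_mean_field_equations
    (α J11 J12 J22 : ℝ) (hα0 : 0 < α) (hα1 : α < 1)
    (hJ11 : 0 < J11) (hJ22 : 0 < J22) (hJ12 : J12 ≠ 0)
    (h1 : J11 < 1 / α) (h2 : J22 < 1 / (1 - α))
    (h3 : (1 - α * J11) * (1 - (1 - α) * J22) ≥ α * (1 - α) * J12 ^ 2) :
    ∀ x1 x2 : ℝ,
      (x1 = Real.tanh (α * J11 * x1 + (1 - α) * J12 * x2) ∧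
       x2 = Real.tanh (α * J12 * x1 + (1 - α) * J22 * x2)) ↔ (x1 = 0 ∧ x2 = 0) := by
  intro x1 x2
  constructor
  · rintro ⟨e1, e2⟩
    have hb : 0 < 1 - α := by linarith
    have hA : 0 < 1 - α * J11 := by
      rw [lt_div_iff₀ hα0] at h1; linarith
    have hform : 0 ≤ α * (1 - α * J11) * x1 ^ 2 - 2 * α * (1 - α) * J12 * x1 * x2
        + (1 - α) * (1 - (1 - α) * J22) * x2 ^ 2 := by
      refine nonneg_of_mul_nonneg_right (a := 1 - α * J11) ?_ hA
      have k1 : 0 ≤ α * ((1 - α * J11) * x1 - (1 - α) * J12 * x2) ^ 2 := by positivity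
      have k2 : 0 ≤ ((1 - α) * x2 ^ 2) *
          ((1 - α * J11) * (1 - (1 - α) * J22) - α * (1 - α) * J12 ^ 2) :=
        mul_nonneg (by positivity) (by linarith)
      linarith
    obtain ⟨y1, hy1⟩ : ∃ y, y = α * J11 * x1 + (1 - α) * J12 * x2 := ⟨_, rfl⟩
    obtain ⟨y2, hy2⟩ : ∃ y, y = α * J12 * x1 + (1 - α) * J22 * x2 := ⟨_, rfl⟩
    rw [← hy1] at e1
    rw [← hy2] at e2
    have l1 := aux_tanh_le y1
    have l2 := aux_tanh_le y2
    rw [← e1] at l1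
    rw [← e2] at l2
    have hsum : α * (y1 * x1 - x1 ^ 2) + (1 - α) * (y2 * x2 - x2 ^ 2) ≤ 0 := by
      rw [hy1, hy2]; linarith
    have m1 := mul_nonneg hα0.le (sub_nonneg.2 l1)
    have m2 := mul_nonneg hb.le (sub_nonneg.2 l2)
    constructor
    · by_contra hx
      have hy : y1 ≠ 0 := by
        rintro rfl; exact hx (by rw [e1, Real.tanh_zero])
      have s := aux_tanh y1 hy
      rw [← e1] at s
      have := mul_pos hα0 (sub_pos.2 s)
      linarith
    · by_contra hx
      have hy : y2 ≠ 0 := by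
        rintro rfl; exact hx (by rw [e2, Real.tanh_zero])
      have s := aux_tanh y2 hy
      rw [← e2] at s
      have := mul_pos hb (sub_pos.2 s)
      linarith
  · rintro ⟨rfl, rfl⟩
    simp

end
end

section
/- Assume α ∈ (0,1), J11 > 0, J22 > 0 and J12 ≠ 0 satisfy conditions (C). Then there exist δ > 0 and N0 such that for all N ≥ N0 with N1 = αN, N2 = (1−α)N positive integers, and all (x1, x2) with |x1| < δ·N1^{1/2} and |x2| < δ·N2^{1/4}, one has N·G̃(x1/N1^{1/2}, x2/N2^{1/4}) ≥ (1/2)(ζ1·x1² + ζ2·x2⁴), where ζ1 = λ_M/(2α) and ζ2 = 2α(α(1−αJ11)² + (1−α)(1−(1−α)J22)²) / (24·(α(1−αJ11) + (1−α)(1−(1−α)J22))²). -/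
noncomputable section
open Real Matrix

/-- Entries of the Hessian matrix of the pressure functional `G` at the origin. -/
def Hess11 (α J11 J12 J22 : ℝ) : ℝ := α^2 * J11 * (1 - α * J11) - α^2 * (1-α) * J12^2
def Hess12 (α J11 J12 J22 : ℝ) : ℝ := α * (1-α) * J12 * (1 - α * J11 - (1-α) * J22)
def Hess22 (α J11 J12 J22 : ℝ) : ℝ :=
  (1-α)^2 * J22 * (1 - (1-α) * J22) - α * (1-α)^2 * J12^2

/-- The largest eigenvalue of the Hessian of `G` at the origin. -/
def lamM (α J11 J12 J22 : ℝ) : ℝ :=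
  (1/2) * (Hess11 α J11 J12 J22 + Hess22 α J11 J12 J22
    + Real.sqrt ((Hess11 α J11 J12 J22 - Hess22 α J11 J12 J22)^2
      + 4 * (Hess12 α J11 J12 J22)^2))

/-- The smallest eigenvalue of the Hessian of `G` at the origin. -/
def lamm (α J11 J12 J22 : ℝ) : ℝ :=
  (1/2) * (Hess11 α J11 J12 J22 + Hess22 α J11 J12 J22
    - Real.sqrt ((Hess11 α J11 J12 J22 - Hess22 α J11 J12 J22)^2
      + 4 * (Hess12 α J11 J12 J22)^2))

/-- Eigenvector of the Hessian for the eigenvalue `lamM`. -/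
def vM (α J11 J12 J22 : ℝ) : Fin 2 → ℝ :=
  ![1, (lamM α J11 J12 J22 - Hess11 α J11 J12 J22) / Hess12 α J11 J12 J22]

/-- Eigenvector of the Hessian for the eigenvalue `lamm`. -/
def vm (α J11 J12 J22 : ℝ) : Fin 2 → ℝ :=
  ![1, (lamm α J11 J12 J22 - Hess11 α J11 J12 J22) / Hess12 α J11 J12 J22]

/-- Euclidean norm of a vector of `ℝ²`. -/
def vnorm (v : Fin 2 → ℝ) : ℝ := Real.sqrt (v 0 ^ 2 + v 1 ^ 2)

/-- The orthogonal matrix whose rows are the normalized eigenvectors of the Hessian. -/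
def Pmat (α J11 J12 J22 : ℝ) : Matrix (Fin 2) (Fin 2) ℝ :=
  Matrix.of ![(vnorm (vM α J11 J12 J22))⁻¹ • vM α J11 J12 J22,
              (vnorm (vm α J11 J12 J22))⁻¹ • vm α J11 J12 J22]

/-- `G̃(x1,x2) = G(P⁻¹(x1,x2))`. -/
def Gtil (α J11 J12 J22 x1 x2 : ℝ) : ℝ :=
  presG α J11 J12 J22 ((Pmat α J11 J12 J22)⁻¹.mulVec ![x1, x2] 0)
    ((Pmat α J11 J12 J22)⁻¹.mulVec ![x1, x2] 1)

/-- `A² = diag(α, 1-α)`. -/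
def Asq (α : ℝ) : Matrix (Fin 2) (Fin 2) ℝ := Matrix.diagonal ![α, 1 - α]

/-- `J̃ = P⁻¹ A² J A² P`. -/
def Jtil (α J11 J12 J22 : ℝ) : Matrix (Fin 2) (Fin 2) ℝ :=
  (Pmat α J11 J12 J22)⁻¹ * Asq α * Jmat J11 J12 J22 * Asq α * Pmat α J11 J12 J22

lemma logcosh_le (z : ℝ) (hz : |z| ≤ 1/2) :
    Real.log (Real.cosh z) ≤ z^2/2 - z^4/16 := by
  rw [Real.log_le_iff_le_exp (Real.cosh_pos z)]
  have hz1 : |z| ≤ 1 := by linarith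
  have h1 := Real.exp_bound hz1 (n := 6) (by norm_num)
  have h2 := Real.exp_bound (x := -z) (by rwa [abs_neg]) (n := 6) (by norm_num)
  rw [abs_neg] at h2
  have h1 := (abs_le.1 h1).2
  have h2 := (abs_le.1 h2).2
  have h6 : |z|^6 = z^6 := by
    rw [show (6:ℕ) = 2*3 by norm_num, pow_mul, pow_mul, sq_abs]
  rw [h6] at h1 h2
  simp only [Finset.sum_range_succ, Finset.sum_range_zero, Nat.factorial] at h1 h2
  norm_num at h1 h2
  have hz2 : z^2 ≤ 1/4 := by
    have := sq_abs z
    nlinarith [abs_nonneg z]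
  have hw : 0 ≤ z^2/2 - z^4/16 := by nlinarith [sq_nonneg z]
  have he := Real.quadratic_le_exp_of_nonneg hw
  have h4 : 0 ≤ z^4 := by positivity
  have h8 : 0 ≤ z^8 := by positivity
  have h64 : z^6 ≤ z^4/4 := by nlinarith
  rw [Real.cosh_eq]
  nlinarith

lemma quart (p q : ℝ) : (q+p)^4 ≥ 2/3*q^4 - 864*p^4 := by
  nlinarith [sq_nonneg (q^2/6*2+2*p*q*6/2), sq_nonneg (q^2+12*p*q), sq_nonneg (q^2-144*p^2/2), sq_nonneg (p*(2*q+p)), sq_nonneg (p*q)]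

lemma lamM_eq (α J11 J12 J22 : ℝ) (hα0 : 0 < α) (hα1 : α < 1)
    (ha : 0 < 1 - α * J11) (hb : 0 < 1 - (1-α) * J22)
    (hC4 : (1 - α * J11) * (1 - (1 - α) * J22) = α * (1 - α) * J12 ^ 2)
    (hC5 : 1 < α * J11 + (1 - α) * J22) :
    let a := 1 - α * J11
    let b := 1 - (1-α) * J22
    Hess11 α J11 J12 J22 = α*a*(1-a-b) ∧ Hess22 α J11 J12 J22 = (1-α)*b*(1-a-b) ∧
    lamM α J11 J12 J22 = (α*a+(1-α)*b)*(1-a-b) ∧ lamm α J11 J12 J22 = 0 := by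
  intro a b
  have e1 : Hess11 α J11 J12 J22 = α*a*(1-a-b) := by
    simp only [Hess11, a, b]; linear_combination α * hC4
  have e2 : Hess22 α J11 J12 J22 = (1-α)*b*(1-a-b) := by
    simp only [Hess22, a, b]; linear_combination (1-α) * hC4
  have hs : 0 < 1 - a - b := by simp only [a, b]; linarith
  have hβ : 0 < 1 - α := by linarith
  have e3 : (Hess12 α J11 J12 J22)^2 = Hess11 α J11 J12 J22 * Hess22 α J11 J12 J22 := by
    rw [e1, e2]; simp only [Hess12, a, b]
    linear_combination -α*(1-α)*(1 - α * J11 - (1-α) * J22)^2 * hC4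
  have e4 : Real.sqrt ((Hess11 α J11 J12 J22 - Hess22 α J11 J12 J22)^2
      + 4 * (Hess12 α J11 J12 J22)^2) = (α*a+(1-α)*b)*(1-a-b) := by
    rw [e3, e1, e2, Real.sqrt_eq_iff_mul_self_eq_of_pos (by positivity)]
    ring
  refine ⟨e1, e2, ?_, ?_⟩
  · rw [lamM, e4, e1, e2]; ring
  · rw [lamm, e4, e1, e2]; ring

lemma Gtil_eq (α J11 J12 J22 y1 y2 k l m n : ℝ) (hkl : k * l = 1)
    (hM : vM α J11 J12 J22 = ![1, -l]) (hm : vm α J11 J12 J22 = ![1, k])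
    (hmp : 0 < m) (hm2 : m^2 = 1 + l^2) (hnp : 0 < n) (hn2 : n^2 = 1 + k^2) :
    Gtil α J11 J12 J22 y1 y2 =
      presG α J11 J12 J22 (y1/m + y2/n) (-l*(y1/m) + k*(y2/n)) := by
  have n1 : vnorm (vM α J11 J12 J22) = m := by
    rw [hM, vnorm, Real.sqrt_eq_iff_mul_self_eq_of_pos hmp]; simp; linarith
  have n2 : vnorm (vm α J11 J12 J22) = n := by
    rw [hm, vnorm, Real.sqrt_eq_iff_mul_self_eq_of_pos hnp]; simp; linarith
  have hP : Pmat α J11 J12 J22 = !![m⁻¹, -l*m⁻¹; n⁻¹, k*n⁻¹] := by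
    rw [Pmat, n1, n2, hM, hm]
    ext i j; fin_cases i <;> fin_cases j <;> simp [mul_comm]
  have hi : (Pmat α J11 J12 J22)⁻¹ = !![m⁻¹, n⁻¹; -l*m⁻¹, k*n⁻¹] := by
    rw [hP]
    apply Matrix.inv_eq_right_inv
    have a1 : m⁻¹*m⁻¹ + l*m⁻¹*(l*m⁻¹) = 1 := by
      field_simp; linarith
    have a2 : n⁻¹*n⁻¹ + k*n⁻¹*(k*n⁻¹) = 1 := by
      field_simp; linarith
    have a3 : m⁻¹*n⁻¹ - l*m⁻¹*(k*n⁻¹) = 0 := by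
      linear_combination -m⁻¹*n⁻¹*hkl
    ext i j; fin_cases i <;> fin_cases j <;> simp <;> linarith
  rw [Gtil, hi]
  simp [Matrix.mulVec, dotProduct, Fin.sum_univ_two]
  congr 1 <;> ring

set_option maxHeartbeats 1000000 in
lemma core (α J11 J12 J22 : ℝ) (hα0 : 0 < α) (hα1 : α < 1) (hJ12 : J12 ≠ 0)
    (ha : 0 < 1 - α * J11) (hb : 0 < 1 - (1-α) * J22)
    (hC4 : (1 - α * J11) * (1 - (1 - α) * J22) = α * (1 - α) * J12 ^ 2)
    (hC5 : 1 < α * J11 + (1 - α) * J22) :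
    ∃ δ > (0:ℝ), ∀ y1 y2 : ℝ, |y1| < δ → |y2| < δ →
      Gtil α J11 J12 J22 y1 y2 ≥ lamM α J11 J12 J22 / 4 * y1^2 +
        α * (1-α) * (α * (1 - α * J11) ^ 2 + (1 - α) * (1 - (1 - α) * J22) ^ 2) /
          (24 * (α * (1 - α * J11) + (1 - α) * (1 - (1 - α) * J22)) ^ 2) * y2 ^ 4 := by
  obtain ⟨e1, e2, e3, e4⟩ := lamM_eq α J11 J12 J22 hα0 hα1 ha hb hC4 hC5
  have hβ : 0 < 1 - α := by linarith
  obtain ⟨β, hββ⟩ : ∃ β, β = 1 - α := ⟨_, rfl⟩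
  simp only [← hββ] at e1 e2 e3 hb hC4 hC5 hβ ⊢
  obtain ⟨a, haa⟩ : ∃ a, a = 1 - α * J11 := ⟨_, rfl⟩
  obtain ⟨b, hbb⟩ : ∃ b, b = 1 - β * J22 := ⟨_, rfl⟩
  simp only [← haa, ← hbb] at e1 e2 e3 ha hb hC4 ⊢
  have e5 : Hess12 α J11 J12 J22 = -(α * β * J12 * (1-a-b)) := by
    rw [Hess12, ← hββ, haa, hbb]; ring
  have hs : 0 < 1 - a - b := by linarith
  have hsn := hs.ne'
  have hL : 0 < α*a+β*b := by positivity
  obtain ⟨k, hk⟩ : ∃ k, k = a/(β*J12) := ⟨_, rfl⟩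
  obtain ⟨l, hl⟩ : ∃ l, l = b/(α*J12) := ⟨_, rfl⟩
  have hk' : β*J12*k = a := by rw [hk]; field_simp
  have hl' : α*J12*l = b := by rw [hl]; field_simp
  have hkl : k*l = 1 := by
    rw [hk, hl]; field_simp; linarith
  have hM : vM α J11 J12 J22 = ![1, -l] := by
    have : (lamM α J11 J12 J22 - Hess11 α J11 J12 J22) / Hess12 α J11 J12 J22 = -l := by
      rw [e3, e1, e5, hl]; field_simp; ring
    rw [vM, this]
  have hm : vm α J11 J12 J22 = ![1, k] := by
    have : (lamm α J11 J12 J22 - Hess11 α J11 J12 J22) / Hess12 α J11 J12 J22 = k := by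
      rw [e4, e1, e5, hk]; field_simp; ring
    rw [vm, this]
  obtain ⟨m, hmm⟩ : ∃ m, m = Real.sqrt (1+l^2) := ⟨_, rfl⟩
  obtain ⟨n, hnn⟩ : ∃ n, n = Real.sqrt (1+k^2) := ⟨_, rfl⟩
  have hmp : 0 < m := by rw [hmm]; positivity
  have hnp : 0 < n := by rw [hnn]; positivity
  have hm2 : m^2 = 1+l^2 := by rw [hmm]; exact Real.sq_sqrt (by positivity)
  have hn2 : n^2 = 1+k^2 := by rw [hnn]; exact Real.sq_sqrt (by positivity)
  have hm1 : 1 ≤ m := by nlinarith [sq_nonneg l]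
  have hn1 : 1 ≤ n := by nlinarith [sq_nonneg k]
  have hk2 : β*b*k^2 = α*a := by
    rw [hk]; field_simp; linear_combination hC4
  have hl2 : α*a*l^2 = β*b := by
    rw [hl]; field_simp; linear_combination hC4
  obtain ⟨c1, hc1⟩ : ∃ c, c = α*J11 - β*J12*l := ⟨_, rfl⟩
  obtain ⟨c2, hc2⟩ : ∃ c, c = α*J12 - β*J22*l := ⟨_, rfl⟩
  have hΛ : 0 < lamM α J11 J12 J22 := by rw [e3]; positivity
  obtain ⟨Λ, hΛΛ⟩ : ∃ L, L = lamM α J11 J12 J22 := ⟨_, rfl⟩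
  rw [← hΛΛ] at hΛ e3 ⊢
  have hMM : 0 < 1 + |c1| + |k| + |c2| := by positivity
  have hD : 0 < 216 * (c1^4+c2^4+1) := by positivity
  refine ⟨min (1/(2*(1 + |c1| + |k| + |c2|))) (Λ/(216 * (c1^4+c2^4+1))), by positivity, ?_⟩
  intro y1 y2 hy1 hy2
  rw [lt_min_iff] at hy1 hy2
  obtain ⟨hy1, hy1'⟩ := hy1
  obtain ⟨hy2, -⟩ := hy2
  rw [lt_div_iff₀ (by positivity)] at hy1 hy2 hy1'
  rw [Gtil_eq α J11 J12 J22 y1 y2 k l m n hkl hM hm hmp hm2 hnp hn2]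
  obtain ⟨p, hp⟩ : ∃ p, p = y1/m := ⟨_, rfl⟩
  obtain ⟨q, hq⟩ : ∃ q, q = y2/n := ⟨_, rfl⟩
  rw [← hp, ← hq]
  have hpy : |p| ≤ |y1| := by
    rw [hp, abs_div, abs_of_pos hmp]; exact div_le_self (abs_nonneg _) hm1
  have hqy : |q| ≤ |y2| := by
    rw [hq, abs_div, abs_of_pos hnp]; exact div_le_self (abs_nonneg _) hn1
  have hu : α * J11 * (p+q) + (1-α)*J12*(-l*p+k*q) = q + c1*p := by
    rw [← hββ, hc1]; linear_combination q*hk' + q*haa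
  have hkJ : α*J12 + β*J22*k = k := by
    have : β * J12 * (α*J12 + β*J22*k) = β*J12*k := by
      linear_combination -hC4 + β*J22*hk' - hk' + a*hbb
    exact mul_left_cancel₀ (by positivity) this
  have hv : α * J12 * (p+q) + (1-α)*J22*(-l*p+k*q) = k*q + c2*p := by
    rw [← hββ, hc2]; linear_combination q*hkJ
  obtain ⟨d, hd, h12, hdM⟩ : ∃ d : ℝ, 0 ≤ d ∧ (|y1| ≤ d ∧ |y2| ≤ d) ∧ d * (2*(1 + |c1| + |k| + |c2|)) ≤ 1 := by
    refine ⟨max |y1| |y2|, (abs_nonneg y1).trans (le_max_left _ _), ⟨le_max_left _ _, le_max_right _ _⟩, ?_⟩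
    rcases max_choice |y1| |y2| with h | h <;> rw [h] <;> linarith
  have hbu : |q + c1*p| ≤ 1/2 := by
    have h1 : |q + c1*p| ≤ |q| + |c1| * |p| := by rw [← abs_mul]; exact abs_add_le _ _
    have h2 := mul_le_mul_of_nonneg_left (hpy.trans h12.1) (abs_nonneg c1)
    have h3 := hqy.trans h12.2
    have h4 := mul_nonneg hd (abs_nonneg k)
    have h5 := mul_nonneg hd (abs_nonneg c2)
    linarith
  have hbv : |k*q + c2*p| ≤ 1/2 := by
    have h1 : |k*q + c2*p| ≤ |k| * |q| + |c2| * |p| := by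
      rw [← abs_mul, ← abs_mul]; exact abs_add_le _ _
    have h2 := mul_le_mul_of_nonneg_left (hpy.trans h12.1) (abs_nonneg c2)
    have h3 := mul_le_mul_of_nonneg_left (hqy.trans h12.2) (abs_nonneg k)
    have h4 := mul_nonneg hd (abs_nonneg c1)
    linarith
  have gu := logcosh_le _ hbu
  have gv := logcosh_le _ hbv
  have qu := quart (c1*p) q
  have qv := quart (c2*p) (k*q)
  rw [presG, hu, hv, ← hββ]
  have hquad : (1/2) * (α^2 * J11 * (p+q)^2 + 2 * α * β * J12 * (p+q) * (-l*p+k*q) + β^2 * J22 * (-l*p+k*q)^2) - α*((q+c1*p)^2/2) - β*((k*q+c2*p)^2/2) = Λ/2*y1^2 := by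
    have hy : y1 = m*p := by rw [hp]; field_simp
    rw [hy, mul_pow, hm2, e3, ← hu, ← hv, ← hββ]
    have hx : α*a*(p+q)^2 - 2*α*β*J12*(p+q)*(-l*p+k*q) + β*b*(-l*p+k*q)^2 = (α*a+β*b)*(1+l^2)*p^2 := by
      have t1 : α*a*(1) + 2*α*β*J12*l + β*b*l^2 = (α*a+β*b)*(1+l^2) := by
        linear_combination 2*β*hl' - hl2
      have t2 : α*a - α*β*J12*(k-l) - β*b*k*l = 0 := by
        linear_combination -α*hk' + β*hl' - β*b*hkl
      have t3 : α*a - 2*α*β*J12*k + β*b*k^2 = 0 := by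
        linear_combination -2*α*hk' + hk2
      linear_combination p^2*t1 + 2*p*q*t2 + q^2*t3
    have hA : α*J11 = 1-a := by linarith
    have hB : β*J22 = 1-b := by linarith
    have g : ∀ X Y : ℝ, (1/2) * (α^2 * J11 * X^2 + 2 * α * β * J12 * X * Y + β^2 * J22 * Y^2) - α*((α*J11*X+β*J12*Y)^2/2) - β*((α*J12*X+β*J22*Y)^2/2) = (1-a-b)/2*(α*a*X^2 - 2*α*β*J12*X*Y+β*b*Y^2) := by
      intro X Y
      rw [show α^2*J11 = α*(α*J11) by ring, show β^2*J22 = β*(β*J22) by ring, hA, hB]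
      linear_combination (α*X^2+β*Y^2)/2*hC4
    rw [g, hx]; ring
  have hK : α * β * (α * a ^ 2 + β * b ^ 2) / (24 * (α * a + β * b) ^ 2) * y2 ^ 4
      = (α * q^4 + β * (k*q)^4)/24 := by
    have hy : y2 = n*q := by rw [hq]; field_simp
    have hn4 : n^2 * (β*b) = α*a+β*b := by rw [hn2]; linear_combination hk2
    have hn4' : n^4 * (β*b)^2 = (α*a+β*b)^2 := by rw [← hn4]; ring
    have hk4 : k^4 * (β*b)^2 = (α*a)^2 := by rw [← hk2]; ring
    rw [hy, mul_pow, ← hn4']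
    have : k^4 = (α*a)^2/(β*b)^2 := by rw [← hk4]; field_simp
    rw [mul_pow k, this]
    field_simp
    ring
  have hp4 : 54 * (c1^4+c2^4) * p^4 ≤ Λ/4*y1^2 := by
    have hp2 : p^2 ≤ y1^2 := sq_le_sq.2 hpy
    have hy1h : |y1| ≤ 1 := by
      have := abs_nonneg y1
      linarith [mul_nonneg this (abs_nonneg c1), mul_nonneg this (abs_nonneg k), mul_nonneg this (abs_nonneg c2)]
    have hy1s : y1^2 ≤ |y1| := by rw [← sq_abs]; exact (pow_le_of_le_one (abs_nonneg y1) hy1h two_ne_zero)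
    have hp4 : p^4 ≤ |y1| * y1^2 := by
      calc p^4 = p^2*p^2 := by ring
        _ ≤ |y1| * y1^2 := mul_le_mul (hp2.trans hy1s) hp2 (sq_nonneg _) (abs_nonneg _)
    have hc : 0 ≤ c1^4+c2^4 := by positivity
    calc 54 * (c1^4+c2^4) * p^4 ≤ 54 * (c1^4+c2^4) * (|y1| * y1^2) := by gcongr
      _ = (|y1| * (216 * (c1^4+c2^4)))/4 * y1^2 := by ring
      _ ≤ Λ/4*y1^2 := by
        have : |y1| * (216 * (c1^4+c2^4)) ≤ Λ := by linarith [abs_nonneg y1]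
        gcongr
  rw [hK]
  have hgu := mul_le_mul_of_nonneg_left gu hα0.le
  have hgv := mul_le_mul_of_nonneg_left gv hβ.le
  have hqu := mul_le_mul_of_nonneg_left qu hα0.le
  have hqv := mul_le_mul_of_nonneg_left qv hβ.le
  have i1 : α * (c1*p)^4 ≤ (c1*p)^4 := mul_le_of_le_one_left (by positivity) hα1.le
  have i2 : β * (c2*p)^4 ≤ (c2*p)^4 := mul_le_of_le_one_left (by positivity) (by linarith)
  have i3 : (c1*p)^4 + (c2*p)^4 = (c1^4+c2^4)*p^4 := by ring
  linarith

/-- Lower bound for the rescaled pressure functional: under conditions (C) there are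
`δ > 0` and `N0` such that, for `N ≥ N0` with `N1 = αN` and `N2 = (1-α)N` positive
integers, `N G̃(x1/N1^{1/2}, x2/N2^{1/4}) ≥ (1/2)(ζ1 x1² + ζ2 x2⁴)` whenever
`|x1| < δ N1^{1/2}` and `|x2| < δ N2^{1/4}`. -/
theorem rescaled_pressure_lower_bound
    (α J11 J12 J22 : ℝ) (hα0 : 0 < α) (hα1 : α < 1)
    (hJ11 : 0 < J11) (hJ22 : 0 < J22) (hJ12 : J12 ≠ 0)
    (hC2 : J11 < 1 / α) (hC3 : J22 < 1 / (1 - α))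
    (hC4 : (1 - α * J11) * (1 - (1 - α) * J22) = α * (1 - α) * J12 ^ 2)
    (hC5 : 1 < α * J11 + (1 - α) * J22) :
    ∃ δ > (0 : ℝ), ∃ N0 : ℕ, ∀ N : ℕ, N0 ≤ N → ∀ N1 N2 : ℕ,
      0 < N1 → 0 < N2 → (N1 : ℝ) = α * N → (N2 : ℝ) = (1 - α) * N →
      ∀ x1 x2 : ℝ,
        |x1| < δ * (N1 : ℝ) ^ ((1 : ℝ)/2) → |x2| < δ * (N2 : ℝ) ^ ((1 : ℝ)/4) →
        (N : ℝ) * Gtil α J11 J12 J22 (x1 / (N1 : ℝ) ^ ((1 : ℝ)/2))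
            (x2 / (N2 : ℝ) ^ ((1 : ℝ)/4)) ≥
          (1/2) * ((lamM α J11 J12 J22 / (2 * α)) * x1 ^ 2 +
            (2 * α * (α * (1 - α * J11) ^ 2 + (1 - α) * (1 - (1 - α) * J22) ^ 2) /
              (24 * (α * (1 - α * J11) + (1 - α) * (1 - (1 - α) * J22)) ^ 2)) * x2 ^ 4) := by
  have ha : 0 < 1 - α * J11 := by
    rw [lt_div_iff₀ hα0] at hC2; linarith
  have hβ : 0 < 1 - α := by linarith
  have hb : 0 < 1 - (1 - α) * J22 := by
    rw [lt_div_iff₀ hβ] at hC3; linarith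
  obtain ⟨δ, hδ, h⟩ := core α J11 J12 J22 hα0 hα1 hJ12 ha hb hC4 hC5
  refine ⟨δ, hδ, 0, ?_⟩
  intro N _ N1 N2 hN1 hN2 h1 h2 x1 x2 hx1 hx2
  have hN1' : (0:ℝ) < N1 := by exact_mod_cast hN1
  have hN2' : (0:ℝ) < N2 := by exact_mod_cast hN2
  obtain ⟨r, hr⟩ : ∃ r, r = (N1 : ℝ) ^ ((1 : ℝ)/2) := ⟨_, rfl⟩
  obtain ⟨t, ht⟩ : ∃ t, t = (N2 : ℝ) ^ ((1 : ℝ)/4) := ⟨_, rfl⟩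
  have hrp : 0 < r := by rw [hr]; positivity
  have htp : 0 < t := by rw [ht]; positivity
  have hr2 : r^2 = α * N := by
    rw [hr, ← Real.rpow_natCast, ← Real.rpow_mul hN1'.le, ← h1]; norm_num
  have ht4 : t^4 = (1-α) * N := by
    rw [ht, ← Real.rpow_natCast, ← Real.rpow_mul hN2'.le, ← h2]; norm_num
  have hNp : (0:ℝ) < N := by
    rw [h1] at hN1'; exact pos_of_mul_pos_right hN1' hα0.le
  rw [← hr] at hx1 ⊢
  rw [← ht] at hx2 ⊢
  have hh := h (x1/r) (x2/t)
    (by rw [abs_div, abs_of_pos hrp, div_lt_iff₀ hrp]; exact hx1)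
    (by rw [abs_div, abs_of_pos htp, div_lt_iff₀ htp]; exact hx2)
  have hh2 := mul_le_mul_of_nonneg_left hh hNp.le
  refine le_trans (le_of_eq ?_) hh2
  rw [div_pow, div_pow, hr2, ht4]
  have hL : 0 < α * (1 - α * J11) + (1 - α) * (1 - (1 - α) * J22) := by positivity
  field_simp
  ring

end
end

section
/- Assume α ∈ (0,1), J11 > 0, J22 > 0 and J12 ≠ 0 satisfy conditions (C). Then the fourth-order coefficient ζ2 := (1/(4!·(1−α)))·∂⁴G̃/∂x2⁴(0,0) equals 2α(α(1−αJ11)² + (1−α)(1−(1−α)J22)²) / (24·(α(1−αJ11) + (1−α)(1−(1−α)J22))²), and ζ2 is strictly positive. -/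
noncomputable section
open Real Matrix

lemma hasDerivAt_tanh_mul (c t : ℝ) :
    HasDerivAt (fun t => Real.tanh (c * t)) (c * (1 - Real.tanh (c * t) ^ 2)) t := by
  have h1 : HasDerivAt (fun t : ℝ => c * t) c t := by
    simpa using (hasDerivAt_id t).const_mul c
  have h2 := h1.sinh.div h1.cosh (Real.cosh_pos (c * t)).ne'
  have e : (fun t => Real.tanh (c * t)) =
      (fun t => Real.sinh (c * t)) / (fun t => Real.cosh (c * t)) := by
    funext x
    simp [Real.tanh_eq_sinh_div_cosh]
  rw [e]
  refine HasDerivAt.congr_deriv h2 ?_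
  rw [Real.tanh_eq_sinh_div_cosh]
  have := (Real.cosh_pos (c * t)).ne'
  field_simp

lemma hasDerivAt_log_cosh_mul (c t : ℝ) :
    HasDerivAt (fun t => Real.log (Real.cosh (c * t))) (c * Real.tanh (c * t)) t := by
  have h1 : HasDerivAt (fun t : ℝ => c * t) c t := by
    simpa using (hasDerivAt_id t).const_mul c
  have h2 := h1.cosh.log (Real.cosh_pos (c * t)).ne'
  refine HasDerivAt.congr_deriv h2 ?_
  rw [Real.tanh_eq_sinh_div_cosh]
  ring

lemma iteratedDeriv_four_aux (A a b c d : ℝ) :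
    iteratedDeriv 4 (fun t : ℝ => A * t ^ 2 - a * Real.log (Real.cosh (c * t))
      - b * Real.log (Real.cosh (d * t))) 0 = 2 * (a * c ^ 4 + b * d ^ 4) := by
  have d1 : deriv (fun t : ℝ => A * t ^ 2 - a * Real.log (Real.cosh (c * t))
      - b * Real.log (Real.cosh (d * t))) = fun t => 2 * A * t - a * c * Real.tanh (c * t)
      - b * d * Real.tanh (d * t) := by
    funext t
    refine HasDerivAt.deriv ?_
    have := ((((hasDerivAt_id t).pow 2).const_mul A).sub
      ((hasDerivAt_log_cosh_mul c t).const_mul a)).sub ((hasDerivAt_log_cosh_mul d t).const_mul b)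
    refine HasDerivAt.congr_deriv this ?_
    simp; ring
  have d2 : deriv (fun t => 2 * A * t - a * c * Real.tanh (c * t)
      - b * d * Real.tanh (d * t)) = fun t => 2 * A - a * c ^ 2 * (1 - Real.tanh (c * t) ^ 2)
      - b * d ^ 2 * (1 - Real.tanh (d * t) ^ 2) := by
    funext t
    refine HasDerivAt.deriv ?_
    have := (((hasDerivAt_id t).const_mul (2 * A)).sub
      ((hasDerivAt_tanh_mul c t).const_mul (a * c))).sub
        ((hasDerivAt_tanh_mul d t).const_mul (b * d))
    refine HasDerivAt.congr_deriv this ?_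
    ring
  have d3 : deriv (fun t => 2 * A - a * c ^ 2 * (1 - Real.tanh (c * t) ^ 2)
      - b * d ^ 2 * (1 - Real.tanh (d * t) ^ 2)) = fun t =>
      2 * a * c ^ 3 * (Real.tanh (c * t) - Real.tanh (c * t) ^ 3)
      + 2 * b * d ^ 3 * (Real.tanh (d * t) - Real.tanh (d * t) ^ 3) := by
    funext t
    refine HasDerivAt.deriv ?_
    have := ((hasDerivAt_const t (2 * A)).sub
      ((((hasDerivAt_tanh_mul c t).pow 2).const_sub 1).const_mul (a * c ^ 2))).sub
        ((((hasDerivAt_tanh_mul d t).pow 2).const_sub 1).const_mul (b * d ^ 2))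
    refine HasDerivAt.congr_deriv this ?_
    simp; ring
  have d4 : deriv (fun t => 
      2 * a * c ^ 3 * (Real.tanh (c * t) - Real.tanh (c * t) ^ 3)
      + 2 * b * d ^ 3 * (Real.tanh (d * t) - Real.tanh (d * t) ^ 3)) 0
      = 2 * (a * c ^ 4 + b * d ^ 4) := by
    refine HasDerivAt.deriv ?_
    have := ((((hasDerivAt_tanh_mul c 0).sub ((hasDerivAt_tanh_mul c 0).pow 3)).const_mul
        (2 * a * c ^ 3))).add
      (((hasDerivAt_tanh_mul d 0).sub ((hasDerivAt_tanh_mul d 0).pow 3)).const_mul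
        (2 * b * d ^ 3))
    refine HasDerivAt.congr_deriv this ?_
    simp; ring
  rw [iteratedDeriv_succ, iteratedDeriv_succ, iteratedDeriv_succ, iteratedDeriv_succ,
    iteratedDeriv_zero, d1, d2, d3, d4]

/-- Under conditions (C), the coefficient
`ζ2 = (1/(4!(1-α))) ∂⁴G̃/∂x2⁴(0,0)` equals
`2α(α(1-αJ11)² + (1-α)(1-(1-α)J22)²)/(24(α(1-αJ11)+(1-α)(1-(1-α)J22))²)`,
and this quantity is strictly positive. -/
theorem fourth_order_coefficient
    (α J11 J12 J22 : ℝ) (hα0 : 0 < α) (hα1 : α < 1)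
    (hJ11 : 0 < J11) (hJ22 : 0 < J22) (hJ12 : J12 ≠ 0)
    (hC2 : J11 < 1 / α) (hC3 : J22 < 1 / (1 - α))
    (hC4 : (1 - α * J11) * (1 - (1 - α) * J22) = α * (1 - α) * J12 ^ 2)
    (hC5 : 1 < α * J11 + (1 - α) * J22) :
    (1 / ((Nat.factorial 4 : ℝ) * (1 - α))) *
        iteratedDeriv 4 (fun t => Gtil α J11 J12 J22 0 t) 0 =
      2 * α * (α * (1 - α * J11) ^ 2 + (1 - α) * (1 - (1 - α) * J22) ^ 2) /
        (24 * (α * (1 - α * J11) + (1 - α) * (1 - (1 - α) * J22)) ^ 2) ∧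
    0 < 2 * α * (α * (1 - α * J11) ^ 2 + (1 - α) * (1 - (1 - α) * J22) ^ 2) /
        (24 * (α * (1 - α * J11) + (1 - α) * (1 - (1 - α) * J22)) ^ 2) := by
  have hβ : 0 < 1 - α := by linarith
  have hu : 0 < 1 - α * J11 := by
    rw [lt_div_iff₀ hα0] at hC2; nlinarith
  have hv : 0 < 1 - (1 - α) * J22 := by
    rw [lt_div_iff₀ hβ] at hC3; nlinarith
  obtain ⟨β, hβd⟩ : ∃ β, β = 1 - α := ⟨_, rfl⟩
  obtain ⟨u, hud⟩ : ∃ u, u = 1 - α * J11 := ⟨_, rfl⟩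
  obtain ⟨v, hvd⟩ : ∃ v, v = 1 - (1 - α) * J22 := ⟨_, rfl⟩
  have hs : 0 < 1 - u - v := by rw [hud, hvd]; linarith
  have hC : u * v = α * β * J12 ^ 2 := by rw [hud, hvd, hβd]; exact hC4
  have e1 : Hess11 α J11 J12 J22 = α * u * (1 - u - v) := by
    unfold Hess11
    have : α ^ 2 * (1 - α) * J12 ^ 2 = α * (u * v) := by rw [hC, hβd]; ring
    rw [this, ← hud]
    have : α * J11 = 1 - u := by linarith
    linear_combination α * u * this
  have e2 : Hess22 α J11 J12 J22 = β * v * (1 - u - v) := by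
    unfold Hess22
    have : α * (1 - α) ^ 2 * J12 ^ 2 = β * (u * v) := by rw [hC, hβd]; ring
    rw [this, ← hvd, ← hβd]
    have : β * J22 = 1 - v := by rw [hβd]; linarith
    linear_combination β * v * this
  have e12 : Hess12 α J11 J12 J22 = -(α * β * J12 * (1 - u - v)) := by
    unfold Hess12
    rw [hud, hvd, hβd]; ring
  rw [← hud, ← hvd, ← hβd]
  rw [← hud] at hu
  rw [← hvd] at hv
  rw [← hβd] at hβ
  have hw : 0 < α * u + β * v := by positivity
  have hsq : Real.sqrt ((Hess11 α J11 J12 J22 - Hess22 α J11 J12 J22)^2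
      + 4 * (Hess12 α J11 J12 J22)^2) = (α * u + β * v) * (1 - u - v) := by
    rw [e1, e2, e12, Real.sqrt_eq_iff_mul_self_eq (by positivity) (by positivity)]
    linear_combination (-4) * α * β * (1 - u - v) ^ 2 * hC
  have eM : lamM α J11 J12 J22 = (α * u + β * v) * (1 - u - v) := by
    unfold lamM; rw [hsq, e1, e2]; ring
  have em : lamm α J11 J12 J22 = 0 := by
    unfold lamm; rw [hsq, e1, e2]; ring
  have evM : vM α J11 J12 J22 = ![1, -(v / (α * J12))] := by
    unfold vM; rw [eM, e1, e12]
    congr 2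
    field_simp
    ring
  have evm : vm α J11 J12 J22 = ![1, u / (β * J12)] := by
    unfold vm; rw [em, e1, e12]
    congr 2
    field_simp
    ring
  obtain ⟨r, hr⟩ : ∃ r, r = u / (β * J12) := ⟨_, rfl⟩
  obtain ⟨q, hq⟩ : ∃ q, q = -(v / (α * J12)) := ⟨_, rfl⟩
  have hqr : 1 + q * r = 0 := by
    rw [hq, hr]; field_simp; linarith
  have hr2 : r ^ 2 = α * u / (β * v) := by
    rw [hr]; field_simp; linarith
  obtain ⟨n, hn⟩ : ∃ n, n = Real.sqrt (1 + r ^ 2) := ⟨_, rfl⟩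
  obtain ⟨m, hm⟩ : ∃ m, m = Real.sqrt (1 + q ^ 2) := ⟨_, rfl⟩
  have hn0 : 0 < n := by rw [hn]; positivity
  have hm0 : 0 < m := by rw [hm]; positivity
  have hn2 : n ^ 2 = 1 + r ^ 2 := by rw [hn, Real.sq_sqrt (by positivity)]
  have hm2 : m ^ 2 = 1 + q ^ 2 := by rw [hm, Real.sq_sqrt (by positivity)]
  have hP : Pmat α J11 J12 J22 = !![m⁻¹, m⁻¹ * q; n⁻¹, n⁻¹ * r] := by
    unfold Pmat vnorm
    rw [evM, evm, ← hr, ← hq]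
    ext i j
    fin_cases i <;> fin_cases j <;> simp [hm, hn]
  have hPinv : (Pmat α J11 J12 J22)⁻¹ = !![m⁻¹, n⁻¹; m⁻¹ * q, n⁻¹ * r] := by
    apply Matrix.inv_eq_right_inv
    rw [hP]
    ext i j
    fin_cases i <;> fin_cases j <;> simp [Matrix.mul_apply, Fin.sum_univ_two] <;> field_simp <;>
      linarith
  have hJ1 : α * J11 = 1 - u := by linarith
  have hJ2 : β * J22 = 1 - v := by rw [hβd]; linarith
  have hc1 : α * J11 + β * J12 * r = 1 := by
    rw [hr, hJ1]; field_simp; ring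
  have hc2 : α * J12 + β * J22 * r = r := by
    rw [hJ2, hr]; field_simp; linarith
  have hfun : (fun t => Gtil α J11 J12 J22 0 t) = fun t : ℝ =>
      ((1/2) * (α^2 * J11 + 2 * α * β * J12 * r + β^2 * J22 * r^2) * n⁻¹ ^ 2) * t ^ 2
      - α * Real.log (Real.cosh (n⁻¹ * t)) - β * Real.log (Real.cosh ((n⁻¹ * r) * t)) := by
    funext t
    unfold Gtil presG
    rw [hPinv, ← hβd]
    have a0 : (!![m⁻¹, n⁻¹; m⁻¹ * q, n⁻¹ * r].mulVec ![0, t]) 0 = n⁻¹ * t := by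
      simp [Matrix.mulVec, dotProduct, Fin.sum_univ_two]
    have a1 : (!![m⁻¹, n⁻¹; m⁻¹ * q, n⁻¹ * r].mulVec ![0, t]) 1 = n⁻¹ * r * t := by
      simp [Matrix.mulVec, dotProduct, Fin.sum_univ_two]
    rw [a0, a1]
    have b0 : α * J11 * (n⁻¹ * t) + β * J12 * (n⁻¹ * r * t) = n⁻¹ * t := by
      linear_combination n⁻¹ * t * hc1
    have b1 : α * J12 * (n⁻¹ * t) + β * J22 * (n⁻¹ * r * t) = n⁻¹ * r * t := by
      linear_combination n⁻¹ * t * hc2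
    rw [b0, b1]
    ring
  refine ⟨?_, by positivity⟩
  rw [hfun, iteratedDeriv_four_aux]
  have hn4 : n⁻¹ ^ 4 = (β * v / (α * u + β * v)) ^ 2 := by
    have : n⁻¹ ^ 4 = ((n ^ 2)⁻¹) ^ 2 := by
      rw [inv_pow, inv_pow, ← pow_mul]
    rw [this, hn2, hr2]
    congr 1
    field_simp
    ring
  have hr4 : r ^ 4 = (α * u / (β * v)) ^ 2 := by rw [← hr2]; ring
  rw [mul_pow, hn4, hr4]
  simp only [Nat.factorial]
  push_cast
  field_simp
  ring

end
end

section
/- Assume α ∈ (0,1), J11 > 0, J22 > 0, J12 ≠ 0 satisfy conditions (C) and J is positive definite. For δ > 0 let V_N = ℝ² \ ((−δ·N1^{1/2}, δ·N1^{1/2}) × (−δ·N2^{1/4}, δ·N2^{1/4})), with N1 = αN, N2 = (1−α)N. Then for sufficiently small δ > 0 there exists ε > 0 such that for every bounded continuous ψ : ℝ² → ℝ, ∫_{V_N} exp(−N·G̃(x1/N1^{1/2}, x2/N2^{1/4}))·ψ(x1,x2) dx1 dx2 = O(N^{3/4}·e^{−Nε}) as N → ∞ along integers with αN ∈ ℕ.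 -/
noncomputable section
open Real Matrix MeasureTheory Filter Topology

lemma aux_r_nonneg (y : ℝ) : Real.log (Real.cosh y) ≤ y^2/2 := by
  have h := Real.cosh_le_exp_half_sq y
  rw [Real.log_le_iff_le_exp (Real.cosh_pos y)]
  exact h

lemma aux_r_pos (z : ℝ) (hz : |z| ≤ 2) :
    (z / Real.cosh 2)^4 ≤ (2*z)^2/2 - Real.log (Real.cosh (2*z)) := by
  have hc := Real.cosh_pos z
  have h1 : Real.cosh (2*z) = Real.cosh z ^ 4 * (1 - (Real.sinh z / Real.cosh z)^4) := by
    have := Real.cosh_sq z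
    rw [Real.cosh_two_mul]
    field_simp
    nlinarith [this]
  have h2 : Real.cosh (2*z) ≤ Real.cosh z ^ 4 * Real.exp (-(Real.sinh z / Real.cosh z)^4) := by
    rw [h1]
    apply mul_le_mul_of_nonneg_left _ (by positivity)
    have := Real.add_one_le_exp (-(Real.sinh z / Real.cosh z)^4)
    linarith
  have h3 : Real.log (Real.cosh (2*z)) ≤ 4 * Real.log (Real.cosh z) - (Real.sinh z / Real.cosh z)^4 := by
    have := Real.log_le_log (Real.cosh_pos _) h2
    rw [Real.log_mul (by positivity) (by positivity), Real.log_exp, Real.log_pow] at this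
    push_cast at this
    linarith
  have h4 := aux_r_nonneg z
  have h5 : (z / Real.cosh 2)^4 ≤ (Real.sinh z / Real.cosh z)^4 := by
    rw [← Even.pow_abs (by decide : Even 4), ← Even.pow_abs (by decide : Even 4) (Real.sinh z / Real.cosh z)]
    apply pow_le_pow_left₀ (abs_nonneg _)
    rw [abs_div, abs_div, abs_of_pos hc, abs_of_pos (Real.cosh_pos 2)]
    have h6 : |z| ≤ |Real.sinh z| := by
      rw [Real.abs_sinh]
      exact Real.self_le_sinh_iff.2 (abs_nonneg _)
    have h7 : Real.cosh z ≤ Real.cosh 2 := by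
      rw [Real.cosh_le_cosh]; simpa using hz
    gcongr
  nlinarith

lemma aux_r_quad (h : ℝ) (hh : 0 < h) : ∃ k > (0:ℝ), ∀ y : ℝ, h ≤ y^2 →
    k * y^2 ≤ y^2/2 - Real.log (Real.cosh y) := by
  have hc := Real.cosh_pos 2
  refine ⟨min (1/4) (h / (2 * Real.cosh 2)^4), by positivity, fun y hy => ?_⟩
  by_cases hb : |y| ≤ 4
  · have h1 := aux_r_pos (y/2) (by rw [abs_div]; norm_num; linarith)
    rw [show 2 * (y/2) = y by ring] at h1
    have h2 : (h / (2 * Real.cosh 2)^4) * y^2 ≤ (y / 2 / Real.cosh 2)^4 := by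
      rw [show (y / 2 / Real.cosh 2)^4 = (y^2 / (2 * Real.cosh 2)^4) * y^2 by field_simp; try ring]
      gcongr
    have h3 : min (1/4) (h / (2 * Real.cosh 2)^4) * y^2 ≤ (h / (2 * Real.cosh 2)^4) * y^2 := by
      gcongr; exact min_le_right _ _
    linarith
  · push Not at hb
    have h3 : min (1/4) (h / (2 * Real.cosh 2)^4) * y^2 ≤ (1/4) * y^2 := by
      gcongr; exact min_le_left _ _
    have h4 : Real.log (Real.cosh y) ≤ |y| := by
      rw [Real.log_le_iff_le_exp (Real.cosh_pos y), ← Real.cosh_abs, Real.cosh_eq]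
      have : Real.exp (-|y|) ≤ Real.exp |y| := Real.exp_le_exp.2 (by linarith)
      linarith
    have h5 : y^2 = |y|^2 := (sq_abs y).symm
    nlinarith

lemma aux_two (α : ℝ) (hα0 : 0 < α) (hα1 : α < 1) (h : ℝ) (hh : 0 < h) :
    ∃ k > (0:ℝ), ∀ y1 y2 : ℝ, h ≤ y1^2 + y2^2 →
    k * (y1^2 + y2^2) ≤ α * (y1^2/2 - Real.log (Real.cosh y1))
      + (1-α) * (y2^2/2 - Real.log (Real.cosh y2)) := by
  obtain ⟨k, hk, H⟩ := aux_r_quad (h/2) (by positivity)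
  have hα2 : 0 < 1 - α := by linarith
  refine ⟨α * (1-α) * k / 2, by positivity, fun y1 y2 hy => ?_⟩
  have n1 := aux_r_nonneg y1
  have n2 := aux_r_nonneg y2
  have m1 : 0 ≤ α * (y1^2/2 - Real.log (Real.cosh y1)) := mul_nonneg hα0.le (by linarith)
  have m2 : 0 ≤ (1-α) * (y2^2/2 - Real.log (Real.cosh y2)) := mul_nonneg hα2.le (by linarith)
  have e : α * (1-α) ≤ α := by nlinarith
  have e' : α * (1-α) ≤ 1-α := by nlinarith
  rcases le_total (y2^2) (y1^2) with hle | hle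
  · have := H y1 (by linarith)
    have a1 : α * (k * y1^2) ≤ α * (y1^2/2 - Real.log (Real.cosh y1)) := by gcongr
    have a2 : α * (1-α) * k / 2 * (y1^2+y2^2) ≤ α * k / 2 * (y1^2+y1^2) := by gcongr
    linarith
  · have := H y2 (by linarith)
    have a1 : (1-α) * (k * y2^2) ≤ (1-α) * (y2^2/2 - Real.log (Real.cosh y2)) := by gcongr
    have a2 : α * (1-α) * k / 2 * (y1^2+y2^2) ≤ (1-α) * k / 2 * (y2^2+y2^2) := by gcongr
    linarith

lemma aux_presG (α J11 J12 J22 : ℝ) (hα0 : 0 < α) (hα1 : α < 1)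
    (hC2 : J11 < 1 / α)
    (hC4 : (1 - α * J11) * (1 - (1 - α) * J22) = α * (1 - α) * J12 ^ 2)
    (hC5 : 1 < α * J11 + (1 - α) * J22) (x1 x2 : ℝ) :
    α * ((α * J11 * x1 + (1-α) * J12 * x2)^2/2
        - Real.log (Real.cosh (α * J11 * x1 + (1-α) * J12 * x2)))
      + (1-α) * ((α * J12 * x1 + (1-α) * J22 * x2)^2/2
        - Real.log (Real.cosh (α * J12 * x1 + (1-α) * J22 * x2)))
      ≤ presG α J11 J12 J22 x1 x2 := by
  unfold presG
  have hα2 : 0 < 1 - α := by linarith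
  have hs : 0 < 1 - α * J11 := by
    rw [lt_div_iff₀ hα0] at hC2; linarith
  have key : 0 ≤ (α^2 * J11 * x1^2 + 2 * α * (1-α) * J12 * x1 * x2 + (1-α)^2 * J22 * x2^2)
      - α * (α * J11 * x1 + (1-α) * J12 * x2)^2 - (1-α) * (α * J12 * x1 + (1-α) * J22 * x2)^2 := by
    refine nonneg_of_mul_nonneg_right (a := 1 - α * J11) ?_ hs
    have : (1 - α * J11) * ((α^2 * J11 * x1^2 + 2 * α * (1-α) * J12 * x1 * x2 + (1-α)^2 * J22 * x2^2)
      - α * (α * J11 * x1 + (1-α) * J12 * x2)^2 - (1-α) * (α * J12 * x1 + (1-α) * J22 * x2)^2)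
      = (α * J11 + (1 - α) * J22 - 1) * α * ((1 - α * J11) * x1 - (1-α) * J12 * x2)^2 := by
      linear_combination (α * (1 - α * J11) * x1^2 + (1-α)^2 * J22 * x2^2) * hC4
    rw [this]
    have : 0 < α * J11 + (1 - α) * J22 - 1 := by linarith
    positivity
  nlinarith

lemma aux_det (α J11 J12 J22 : ℝ) (hα0 : 0 < α) (hα1 : α < 1) (hJ12 : J12 ≠ 0)
    (hC5 : 1 < α * J11 + (1 - α) * J22) : IsUnit (Pmat α J11 J12 J22).det := by
  have hα2 : 0 < 1 - α := by linarith
  have hH : Hess12 α J11 J12 J22 ≠ 0 := by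
    unfold Hess12
    have : (1 - α * J11 - (1-α) * J22) ≠ 0 := by intro h; linarith
    have := hα0.ne'
    have := hα2.ne'
    positivity
  have hv : ∀ c : ℝ, (vnorm ![1, c])⁻¹ ≠ 0 := by
    intro c
    unfold vnorm
    simp only [Matrix.cons_val_zero, Matrix.cons_val_one]
    positivity
  have hsq : 0 < Real.sqrt ((Hess11 α J11 J12 J22 - Hess22 α J11 J12 J22)^2
      + 4 * (Hess12 α J11 J12 J22)^2) := by
    apply Real.sqrt_pos.2; positivity
  have hd : (lamm α J11 J12 J22 - Hess11 α J11 J12 J22) / Hess12 α J11 J12 J22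
     - (lamM α J11 J12 J22 - Hess11 α J11 J12 J22) / Hess12 α J11 J12 J22 ≠ 0 := by
    rw [← sub_div]
    apply div_ne_zero _ hH
    unfold lamM lamm
    intro h; linarith
  rw [isUnit_iff_ne_zero, Matrix.det_fin_two]
  have h1 := hv ((lamM α J11 J12 J22 - Hess11 α J11 J12 J22) / Hess12 α J11 J12 J22)
  have h2 := hv ((lamm α J11 J12 J22 - Hess11 α J11 J12 J22) / Hess12 α J11 J12 J22)
  unfold Pmat
  unfold vM vm
  simp only [Matrix.of_apply, Matrix.cons_val_zero, Matrix.cons_val_one, Pi.smul_apply, smul_eq_mul]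
  intro h
  apply mul_ne_zero (mul_ne_zero h1 h2) hd
  linarith

lemma aux_Gtil (α J11 J12 J22 : ℝ) (hα0 : 0 < α) (hα1 : α < 1) (hJ12 : J12 ≠ 0)
    (hC2 : J11 < 1 / α)
    (hC4 : (1 - α * J11) * (1 - (1 - α) * J22) = α * (1 - α) * J12 ^ 2)
    (hC5 : 1 < α * J11 + (1 - α) * J22) (hpd : (Jmat J11 J12 J22).PosDef)
    (h : ℝ) (hh : 0 < h) : ∃ k > (0:ℝ), ∀ x1 x2 : ℝ, h ≤ x1^2 + x2^2 →
      k * (x1^2 + x2^2) ≤ Gtil α J11 J12 J22 x1 x2 := by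
  have hα2 : 0 < 1 - α := by linarith
  have hdet := aux_det α J11 J12 J22 hα0 hα1 hJ12 hC5
  have hD : 0 < J11 * J22 - J12 * J12 := by
    have := hpd.det_pos
    simpa [Jmat, Matrix.det_fin_two] using this
  set P := Pmat α J11 J12 J22 with hP
  set D := J11 * J22 - J12 * J12 with hDdef
  -- coefficients of `x = P (J A)⁻¹ y`
  set c : Fin 2 → ℝ := fun i => P i 0 * (J22 / (α * D)) - P i 1 * (J12 / ((1-α) * D)) with hc
  set d : Fin 2 → ℝ := fun i => P i 1 * (J11 / ((1-α) * D)) - P i 0 * (J12 / (α * D)) with hd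
  set K : ℝ := (c 0)^2 + (d 0)^2 + (c 1)^2 + (d 1)^2 + 1 with hK
  have hK0 : 0 < K := by positivity
  obtain ⟨k, hk, H⟩ := aux_two α hα0 hα1 (h / K) (by positivity)
  refine ⟨k / K, by positivity, fun x1 x2 hx => ?_⟩
  unfold Gtil
  set w := (Pmat α J11 J12 J22)⁻¹.mulVec ![x1, x2] with hw
  have hPw : P.mulVec w = ![x1, x2] := by
    rw [hw, Matrix.mulVec_mulVec, Matrix.mul_nonsing_inv _ hdet, Matrix.one_mulVec]
  have e1 : x1 = P 0 0 * w 0 + P 0 1 * w 1 := by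
    have := congrFun hPw 0
    simpa [Matrix.mulVec, dotProduct, Fin.sum_univ_two] using this.symm
  have e2 : x2 = P 1 0 * w 0 + P 1 1 * w 1 := by
    have := congrFun hPw 1
    simpa [Matrix.mulVec, dotProduct, Fin.sum_univ_two] using this.symm
  refine le_trans ?_ (aux_presG α J11 J12 J22 hα0 hα1 hC2 hC4 hC5 (w 0) (w 1))
  set y1 := α * J11 * w 0 + (1-α) * J12 * w 1 with hy1
  set y2 := α * J12 * w 0 + (1-α) * J22 * w 1 with hy2
  have w0 : w 0 = (J22 / (α * D)) * y1 - (J12 / (α * D)) * y2 := by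
    rw [hy1, hy2]; field_simp; rw [hDdef]; ring
  have w1 : w 1 = (J11 / ((1-α) * D)) * y2 - (J12 / ((1-α) * D)) * y1 := by
    rw [hy1, hy2]; field_simp; rw [hDdef]; ring
  clear_value y1 y2
  have f1 : x1 = c 0 * y1 + d 0 * y2 := by
    rw [e1, w0, w1, hc, hd]; ring
  have f2 : x2 = c 1 * y1 + d 1 * y2 := by
    rw [e2, w0, w1, hc, hd]; ring
  have hb : x1^2 + x2^2 ≤ K * (y1^2 + y2^2) := by
    have hcs : ∀ p q : ℝ, (p * y1 + q * y2)^2 ≤ (p^2 + q^2) * (y1^2 + y2^2) := by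
      intro p q
      nlinarith only [sq_nonneg (p * y2 - q * y1)]
    have g1 := hcs (c 0) (d 0)
    have g2 := hcs (c 1) (d 1)
    rw [← f1] at g1
    rw [← f2] at g2
    have g3 : K * (y1^2 + y2^2) = ((c 0)^2 + (d 0)^2) * (y1^2 + y2^2)
      + ((c 1)^2 + (d 1)^2) * (y1^2 + y2^2) + (y1^2 + y2^2) := by rw [hK]; ring
    rw [g3]
    have g4 : 0 ≤ y1^2 + y2^2 := by positivity
    linarith only [g1, g2, g4]
  have h1 : h / K ≤ y1^2 + y2^2 := by
    rw [div_le_iff₀ hK0]; linarith only [hx, hb]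
  refine le_trans ?_ (H y1 y2 h1)
  rw [div_mul_eq_mul_div, div_le_iff₀ hK0]
  have := mul_le_mul_of_nonneg_left hb hk.le
  linarith only [this]

/-- Tail estimate: for sufficiently small `δ > 0` there is `ε > 0` such that for every
bounded continuous `ψ`, the integral over the complement `V_N` of the rectangle
`(-δN1^{1/2}, δN1^{1/2}) × (-δN2^{1/4}, δN2^{1/4})` of
`exp(-N G̃(x1/N1^{1/2}, x2/N2^{1/4})) ψ(x1,x2)` is `O(N^{3/4} e^{-Nε})` as `N → ∞`
along integers with `αN ∈ ℕ`. -/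
theorem tail_integral_estimate
    (α J11 J12 J22 : ℝ) (hα0 : 0 < α) (hα1 : α < 1)
    (hJ11 : 0 < J11) (hJ22 : 0 < J22) (hJ12 : J12 ≠ 0)
    (hC2 : J11 < 1 / α) (hC3 : J22 < 1 / (1 - α))
    (hC4 : (1 - α * J11) * (1 - (1 - α) * J22) = α * (1 - α) * J12 ^ 2)
    (hC5 : 1 < α * J11 + (1 - α) * J22)
    (hpd : (Jmat J11 J12 J22).PosDef) :
    ∃ δ0 > (0 : ℝ), ∀ δ : ℝ, 0 < δ → δ ≤ δ0 → ∃ ε > (0 : ℝ),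
      ∀ ψ : BoundedContinuousFunction (ℝ × ℝ) ℝ, ∃ C : ℝ, ∃ N0 : ℕ,
        ∀ N : ℕ, N0 ≤ N → ∀ N1 N2 : ℕ,
          0 < N1 → 0 < N2 → (N1 : ℝ) = α * N → (N2 : ℝ) = (1 - α) * N →
          |∫ x in (Set.Ioo (-(δ * (N1 : ℝ) ^ ((1 : ℝ)/2))) (δ * (N1 : ℝ) ^ ((1 : ℝ)/2)) ×ˢ
              Set.Ioo (-(δ * (N2 : ℝ) ^ ((1 : ℝ)/4))) (δ * (N2 : ℝ) ^ ((1 : ℝ)/4)))ᶜ,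
            Real.exp (-(N : ℝ) * Gtil α J11 J12 J22 (x.1 / (N1 : ℝ) ^ ((1 : ℝ)/2))
              (x.2 / (N2 : ℝ) ^ ((1 : ℝ)/4))) * ψ x| ≤
          C * (N : ℝ) ^ ((3 : ℝ)/4) * Real.exp (-(N : ℝ) * ε) := by
  refine ⟨1, one_pos, fun δ hδ _ => ?_⟩
  obtain ⟨k, hk, H⟩ := aux_Gtil α J11 J12 J22 hα0 hα1 hJ12 hC2 hC4 hC5 hpd (δ^2) (by positivity)
  refine ⟨k * δ^2 / 2, by positivity, fun ψ => ⟨‖ψ‖ * (2 * π / k), 1, ?_⟩⟩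
  intro N hN N1 N2 hN1 hN2 e1 e2
  have hα2 : 0 < 1 - α := by linarith
  have hNr : (1:ℝ) ≤ N := by exact_mod_cast hN
  have hN1r : (0:ℝ) < N1 := by exact_mod_cast hN1
  have hN2r : (0:ℝ) < N2 := by exact_mod_cast hN2
  have ha : 0 < (N1 : ℝ) ^ ((1 : ℝ)/2) := by positivity
  have hb : 0 < (N2 : ℝ) ^ ((1 : ℝ)/4) := by positivity
  have hab : (N1 : ℝ) ^ ((1 : ℝ)/2) * (N2 : ℝ) ^ ((1 : ℝ)/4) ≤ (N : ℝ) ^ ((3 : ℝ)/4) := by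
    have i1 : (N1 : ℝ) ^ ((1 : ℝ)/2) ≤ (N : ℝ) ^ ((1 : ℝ)/2) :=
      Real.rpow_le_rpow hN1r.le (by nlinarith) (by norm_num)
    have i2 : (N2 : ℝ) ^ ((1 : ℝ)/4) ≤ (N : ℝ) ^ ((1 : ℝ)/4) :=
      Real.rpow_le_rpow hN2r.le (by nlinarith) (by norm_num)
    calc _ ≤ (N : ℝ) ^ ((1 : ℝ)/2) * (N : ℝ) ^ ((1 : ℝ)/4) := by gcongr
      _ = _ := by rw [← Real.rpow_add (by linarith)]; norm_num
  set a := (N1 : ℝ) ^ ((1 : ℝ)/2)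
  set b := (N2 : ℝ) ^ ((1 : ℝ)/4)
  clear_value a b
  set E := Real.exp (-(N : ℝ) * (k * δ^2 / 2)) with hE
  let g : ℝ × ℝ → ℝ := fun x => (‖ψ‖ * E) *
    (Real.exp (-(k / (2 * a^2)) * x.1^2) * Real.exp (-(k / (2 * b^2)) * x.2^2))
  have hgi : Integrable g := by
    apply Integrable.const_mul
    exact (integrable_exp_neg_mul_sq (b := k / (2 * a^2)) (by positivity)).mul_prod
      (integrable_exp_neg_mul_sq (b := k / (2 * b^2)) (by positivity))
  have hg0 : ∀ x, 0 ≤ g x := fun x => by positivity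
  have hgint : ∫ x, g x = (‖ψ‖ * E) * (2 * π / k * (a * b)) := by
    simp only [g]
    rw [integral_const_mul, Measure.volume_eq_prod,
      integral_prod_mul (fun x : ℝ => Real.exp (-(k / (2 * a^2)) * x^2))
      (fun x : ℝ => Real.exp (-(k / (2 * b^2)) * x^2)), integral_gaussian, integral_gaussian,
      ← Real.sqrt_mul (by positivity)]
    congr 1
    rw [show π / (k / (2 * a ^ 2)) * (π / (k / (2 * b ^ 2))) = (2 * π / k * (a * b))^2 by
      field_simp; try ring]
    exact Real.sqrt_sq (by positivity)
  have hms : MeasurableSet (Set.Ioo (-(δ * a)) (δ * a) ×ˢ Set.Ioo (-(δ * b)) (δ * b))ᶜ :=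
    (measurableSet_Ioo.prod measurableSet_Ioo).compl
  rw [← Real.norm_eq_abs]
  have hbound := norm_integral_le_of_norm_le (f := fun x : ℝ × ℝ =>
    Real.exp (-(N : ℝ) * Gtil α J11 J12 J22 (x.1 / a) (x.2 / b)) * ψ x)
    (μ := volume.restrict (Set.Ioo (-(δ * a)) (δ * a) ×ˢ Set.Ioo (-(δ * b)) (δ * b))ᶜ)
    (g := g) hgi.integrableOn (by
      rw [ae_restrict_iff' hms]
      refine Eventually.of_forall fun x hx => ?_
      have hx2 : δ^2 ≤ (x.1 / a)^2 + (x.2 / b)^2 := by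
        by_contra hcon
        push Not at hcon
        apply hx
        have j1 : |x.1 / a| < δ := abs_lt_of_sq_lt_sq (by nlinarith [sq_nonneg (x.2 / b)]) hδ.le
        have j2 : |x.2 / b| < δ := abs_lt_of_sq_lt_sq (by nlinarith [sq_nonneg (x.1 / a)]) hδ.le
        rw [abs_div, abs_of_pos ha, div_lt_iff₀ ha, abs_lt] at j1
        rw [abs_div, abs_of_pos hb, div_lt_iff₀ hb, abs_lt] at j2
        exact ⟨j1, j2⟩
      have hG := H _ _ hx2
      rw [norm_mul, Real.norm_eq_abs, abs_of_pos (Real.exp_pos _)]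
      have hψ := ψ.norm_coe_le_norm x
      have hexp : Real.exp (-(N : ℝ) * Gtil α J11 J12 J22 (x.1 / a) (x.2 / b)) ≤
          E * (Real.exp (-(k / (2 * a^2)) * x.1^2) * Real.exp (-(k / (2 * b^2)) * x.2^2)) := by
        rw [hE, ← Real.exp_add, ← Real.exp_add, Real.exp_le_exp]
        have q : -(k / (2 * a^2)) * x.1^2 + -(k / (2 * b^2)) * x.2^2
            = -(k/2 * ((x.1 / a)^2 + (x.2 / b)^2)) := by field_simp; ring
        rw [q]
        set S := (x.1 / a)^2 + (x.2 / b)^2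
        have hS : 0 ≤ S := by positivity
        have q1 : (N:ℝ) * (k * S) ≤ N * Gtil α J11 J12 J22 (x.1 / a) (x.2 / b) := by gcongr
        have q2 : (N:ℝ) * (k * δ^2 / 2) ≤ N * (k * S / 2) := by gcongr
        have q3 : 1 * (k * S / 2) ≤ N * (k * S / 2) := by gcongr
        linarith
      calc _ ≤ (E * (Real.exp (-(k / (2 * a^2)) * x.1^2) * Real.exp (-(k / (2 * b^2)) * x.2^2)))
            * ‖ψ‖ := by gcongr
        _ = g x := by simp only [g]; ring)
  refine hbound.trans ((setIntegral_le_integral hgi (Eventually.of_forall hg0)).trans ?_)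
  rw [hgint]
  calc (‖ψ‖ * E) * (2 * π / k * (a * b)) ≤ (‖ψ‖ * E) * (2 * π / k * (N : ℝ) ^ ((3 : ℝ)/4)) := by
        gcongr
    _ = _ := by ring


end
end

section
/- Assume α ∈ (0,1), J11 > 0, J22 > 0, J12 ≠ 0 satisfy conditions (C) and J is positive definite. Then for every bounded continuous function ψ : ℝ² → ℝ, as N → ∞ along integers with N1 = αN ∈ ℕ and N2 = (1−α)N: [∬_{ℝ²} exp(−N·G̃(x1/N1^{1/2}, x2/N2^{1/4}))·ψ(x1,x2) dx1 dx2] / [∬_{ℝ²} exp(−N·G̃(x1/N1^{1/2}, x2/N2^{1/4})) dx1 dx2] → [∬_{ℝ²} exp(−ζ1·x1² − ζ2·x2⁴)·ψ(x1,x2) dx1 dx2] / [∬_{ℝ²} exp(−ζ1·x1² − ζ2·x2⁴) dx1 dx2], where ζ1 = λ_M/(2α) and ζ2 = 2α(α(1−αJ11)² + (1−α)(1−(1−α)J22)²) / (24·(α(1−αJ11) + (1−α)(1−(1−α)J22))²). -/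
noncomputable section
open Real Matrix MeasureTheory Filter Topology

/-- The first coefficient `ζ1 = λ_M/(2α)`. -/
def zeta1 (α J11 J12 J22 : ℝ) : ℝ := lamM α J11 J12 J22 / (2 * α)

/-- The second coefficient `ζ2`. -/
def zeta2 (α J11 J12 J22 : ℝ) : ℝ :=
  2 * α * (α * (1 - α * J11) ^ 2 + (1 - α) * (1 - (1 - α) * J22) ^ 2) /
    (24 * (α * (1 - α * J11) + (1 - α) * (1 - (1 - α) * J22)) ^ 2)

/-- The remainder `y²/2 - log cosh y`. -/
def remF (y : ℝ) : ℝ := y ^ 2 / 2 - Real.log (Real.cosh y)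

lemma remF_even (y : ℝ) : remF (-y) = remF y := by simp [remF]

lemma remF_zero : remF 0 = 0 := by simp [remF]

lemma nonneg_of_deriv (g g' : ℝ → ℝ) (h : ∀ y, HasDerivAt g (g' y) y) (h0 : g 0 = 0)
    (hp : ∀ y, 0 ≤ y → 0 ≤ g' y) (y : ℝ) (hy : 0 ≤ y) : 0 ≤ g y := by
  have hm : MonotoneOn g (Set.Ici 0) := by
    apply monotoneOn_of_deriv_nonneg (convex_Ici 0)
    · exact fun x _ => (h x).continuousAt.continuousWithinAt
    · exact fun x _ => (h x).differentiableAt.differentiableWithinAt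
    · intro x hx
      rw [interior_Ici] at hx
      rw [(h x).deriv]
      exact hp x (le_of_lt hx)
  have := hm (Set.self_mem_Ici) (show y ∈ Set.Ici 0 from hy) hy
  rwa [h0] at this

lemma hasDerivAt_th (y : ℝ) : HasDerivAt (fun y => Real.sinh y / Real.cosh y)
    (1 - (Real.sinh y / Real.cosh y) ^ 2) y := by
  have hc := (Real.cosh_pos y).ne'
  refine HasDerivAt.congr_deriv ((Real.hasDerivAt_sinh y).div (Real.hasDerivAt_cosh y) hc) ?_
  field_simp

lemma hasDerivAt_remF (y : ℝ) : HasDerivAt remF (y - Real.sinh y / Real.cosh y) y := by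
  have hc := (Real.cosh_pos y).ne'
  have h1 : HasDerivAt (fun y : ℝ => y ^ 2 / 2) y y := by
    refine HasDerivAt.congr_deriv (((hasDerivAt_id y).pow 2).div_const 2) ?_
    simp
  exact h1.sub ((Real.hasDerivAt_cosh y).log hc)

lemma th_sq_le (y : ℝ) (hy : 0 ≤ y) : (Real.sinh y / Real.cosh y) ^ 2 ≤ y ^ 2 := by
  have h1 : 0 ≤ y - Real.sinh y / Real.cosh y := by
    refine nonneg_of_deriv (fun y => y - Real.sinh y / Real.cosh y)
      (fun y => 1 - (1 - (Real.sinh y / Real.cosh y) ^ 2)) ?_ (by simp) ?_ y hy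
    · intro x
      exact (hasDerivAt_id x).sub (hasDerivAt_th x)
    · intro x _
      have := sq_nonneg (Real.sinh x / Real.cosh x)
      linarith
  have h2 : 0 ≤ Real.sinh y / Real.cosh y :=
    div_nonneg (Real.sinh_nonneg_iff.2 hy) (Real.cosh_pos y).le
  exact pow_le_pow_left₀ h2 (by linarith) 2

lemma le_th_sq (y : ℝ) (hy : 0 ≤ y) : y ^ 2 / (1 + y ^ 2) ≤ (Real.sinh y / Real.cosh y) ^ 2 := by
  have h1 : y ≤ Real.sinh y := Real.self_le_sinh_iff.2 hy
  have h2 : y ^ 2 ≤ Real.sinh y ^ 2 := pow_le_pow_left₀ hy h1 2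
  rw [div_pow, Real.cosh_sq, div_le_div_iff₀ (by positivity) (by positivity)]
  nlinarith

lemma remF_le_of_nonneg (y : ℝ) (hy : 0 ≤ y) : remF y ≤ y ^ 4 / 12 := by
  have key : ∀ y : ℝ, 0 ≤ y → 0 ≤ y ^ 3 / 3 - (y - Real.sinh y / Real.cosh y) := by
    refine nonneg_of_deriv _ (fun y => y ^ 2 - (1 - (1 - (Real.sinh y / Real.cosh y) ^ 2)))
      ?_ (by simp) ?_
    · intro x
      refine HasDerivAt.sub ?_ ((hasDerivAt_id x).sub (hasDerivAt_th x))
      refine HasDerivAt.congr_deriv (((hasDerivAt_id x).pow 3).div_const 3) ?_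
      simp
    · intro x hx
      have := th_sq_le x hx
      linarith
  have := nonneg_of_deriv (fun y => y ^ 4 / 12 - remF y) _ (fun x => by
      refine HasDerivAt.sub (f' := x ^ 3 / 3) ?_ (hasDerivAt_remF x)
      refine HasDerivAt.congr_deriv (((hasDerivAt_id x).pow 4).div_const 12) ?_
      simp; ring) (by simp [remF_zero]) key y hy
  linarith

lemma le_remF_of_nonneg (y : ℝ) (hy : 0 ≤ y) : y ^ 4 / (12 * (1 + y ^ 2)) ≤ remF y := by
  have hder : ∀ x : ℝ, HasDerivAt (fun y : ℝ => 1 + y ^ 2) (2 * x) x := by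
    intro x
    refine HasDerivAt.congr_deriv (((hasDerivAt_id x).pow 2).const_add 1) ?_
    simp
  have key : ∀ y : ℝ, 0 ≤ y → 0 ≤ (y - Real.sinh y / Real.cosh y)
      - (2 * y ^ 3 + y ^ 5) / (6 * (1 + y ^ 2) ^ 2) := by
    refine nonneg_of_deriv _ (fun y => (1 - (1 - (Real.sinh y / Real.cosh y) ^ 2))
      - (12 * y ^ 2 + 6 * y ^ 4 + 2 * y ^ 6) / (12 * (1 + y ^ 2) ^ 3))
      ?_ (by simp) ?_
    · intro x
      refine HasDerivAt.sub ((hasDerivAt_id x).sub (hasDerivAt_th x)) ?_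
      have hn : HasDerivAt (fun y : ℝ => 2 * y ^ 3 + y ^ 5) (6 * x ^ 2 + 5 * x ^ 4) x := by
        refine HasDerivAt.congr_deriv ((((hasDerivAt_id x).pow 3).const_mul 2).add ((hasDerivAt_id x).pow 5)) ?_
        simp; ring
      have hd : HasDerivAt (fun y : ℝ => 6 * (1 + y ^ 2) ^ 2)
          (6 * (2 * (1 + x ^ 2) * (2 * x))) x := by
        refine HasDerivAt.congr_deriv (((hder x).pow 2).const_mul 6) ?_
        simp
      have hne : (1 + x ^ 2) ≠ 0 := by positivity
      refine HasDerivAt.congr_deriv (hn.div hd (by positivity)) ?_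
      field_simp
      ring
    · intro x hx
      have h1 := le_th_sq x hx
      have h2 : (12 * x ^ 2 + 6 * x ^ 4 + 2 * x ^ 6) / (12 * (1 + x ^ 2) ^ 3)
          ≤ x ^ 2 / (1 + x ^ 2) := by
        rw [div_le_div_iff₀ (by positivity) (by positivity)]
        have : 0 ≤ (1 + x ^ 2) * (18 * x ^ 4 + 10 * x ^ 6) := by positivity
        nlinarith
      linarith
  have := nonneg_of_deriv (fun y => remF y - y ^ 4 / (12 * (1 + y ^ 2))) _ (fun x => by
      refine HasDerivAt.sub (g' := (2 * x ^ 3 + x ^ 5) / (6 * (1 + x ^ 2) ^ 2))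
        (hasDerivAt_remF x) ?_
      have hn : HasDerivAt (fun y : ℝ => y ^ 4) (4 * x ^ 3) x := by
        refine HasDerivAt.congr_deriv (((hasDerivAt_id x).pow 4)) ?_
        simp
      have hne : (1 + x ^ 2) ≠ 0 := by positivity
      refine HasDerivAt.congr_deriv (hn.div ((hder x).const_mul 12) (by positivity)) ?_
      field_simp
      ring) (by simp [remF_zero]) key y hy
  linarith

lemma remF_le (y : ℝ) : remF y ≤ y ^ 4 / 12 := by
  rcases le_total 0 y with h | h
  · exact remF_le_of_nonneg y h
  · have := remF_le_of_nonneg (-y) (by linarith)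
    rw [remF_even] at this
    convert this using 2
    ring

lemma le_remF (y : ℝ) : y ^ 4 / (12 * (1 + y ^ 2)) ≤ remF y := by
  rcases le_total 0 y with h | h
  · exact le_remF_of_nonneg y h
  · have := le_remF_of_nonneg (-y) (by linarith)
    rw [remF_even] at this
    convert this using 2 <;> ring

lemma remF_lower (y δ : ℝ) (h0 : 0 < δ) (h1 : δ ≤ 1) : (δ * y ^ 2 - δ ^ 2) / 12 ≤ remF y := by
  refine le_trans ?_ (le_remF y)
  rw [div_le_div_iff₀ (by positivity) (by positivity)]
  have h3 : 0 ≤ (1 - δ) * (2 * y ^ 2 - δ) ^ 2 := mul_nonneg (by linarith) (sq_nonneg _)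
  have h4 : 0 ≤ δ ^ 2 * (3 + δ) := by positivity
  nlinarith

lemma continuous_remF : Continuous remF :=
  continuous_iff_continuousAt.2 fun y => (hasDerivAt_remF y).continuousAt

lemma remF_limit (a q x1 x2 : ℝ) (u v : ℕ → ℝ)
    (hu : ∀ᶠ N : ℕ in atTop, (N : ℝ) * u N ^ 4 = 1) (hv : Tendsto (fun N : ℕ => v N) atTop (𝓝 0))
    (hu0 : Tendsto u atTop (𝓝 0)) :
    Tendsto (fun N : ℕ => (N : ℝ) * remF (u N * (a * v N * x1 + q * x2))) atTop
      (𝓝 ((q * x2) ^ 4 / 12)) := by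
  have hz : Tendsto (fun N : ℕ => a * v N * x1 + q * x2) atTop (𝓝 (q * x2)) := by
    have := ((hv.const_mul a).mul_const x1).add_const (q * x2)
    simpa using this
  have hup : Tendsto (fun N : ℕ => (a * v N * x1 + q * x2) ^ 4 / 12) atTop
      (𝓝 ((q * x2) ^ 4 / 12)) := (hz.pow 4).div_const 12
  have hlow : Tendsto (fun N : ℕ => (a * v N * x1 + q * x2) ^ 4 /
      (12 * (1 + (u N * (a * v N * x1 + q * x2)) ^ 2))) atTop (𝓝 ((q * x2) ^ 4 / 12)) := by
    have := (hz.pow 4).div ((((hu0.mul hz).pow 2).const_add 1).const_mul 12) (by simp)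
    simp only [mul_zero, zero_mul, ne_eq, OfNat.ofNat_ne_zero, not_false_eq_true, zero_pow,
      add_zero, mul_one] at this
    exact this
  refine tendsto_of_tendsto_of_tendsto_of_le_of_le' hlow hup ?_ ?_
  · filter_upwards [hu] with N hN
    have := mul_le_mul_of_nonneg_left (le_remF (u N * (a * v N * x1 + q * x2)))
      (Nat.cast_nonneg (α := ℝ) N)
    refine le_trans (le_of_eq ?_) this
    rw [← mul_div_assoc, mul_pow (u N) _ 4, ← mul_assoc, hN, one_mul]
  · filter_upwards [hu] with N hN
    have := mul_le_mul_of_nonneg_left (remF_le (u N * (a * v N * x1 + q * x2)))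
      (Nat.cast_nonneg (α := ℝ) N)
    refine le_trans this (le_of_eq ?_)
    rw [← mul_div_assoc, mul_pow (u N) _ 4, ← mul_assoc, hN, one_mul]

lemma rpow_quarter_pow (x : ℝ) (hx : 0 ≤ x) : (x ^ ((1 : ℝ) / 4)) ^ 4 = x := by
  rw [← Real.rpow_natCast, ← Real.rpow_mul hx]
  norm_num

lemma rpow_half_eq (x : ℝ) (hx : 0 ≤ x) : x ^ ((1 : ℝ) / 2) = (x ^ ((1 : ℝ) / 4)) ^ 2 := by
  rw [← Real.rpow_natCast, ← Real.rpow_mul hx]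
  norm_num

lemma remF_nonneg (y : ℝ) : 0 ≤ remF y := le_trans (by positivity) (le_remF y)

/-- Uniform lower bound for the rescaled remainder. -/
lemma remF_scaled_lower (r a q x1 x2 ε : ℝ) (hr : 1 ≤ r) (he0 : 0 ≤ ε) (he1 : ε ≤ 1) :
    ε / 12 * (q ^ 2 * x2 ^ 2 / 2 - a ^ 2 * x1 ^ 2 - 1)
      ≤ r ^ 4 * remF (r⁻¹ * (a * r⁻¹ * x1 + q * x2)) := by
  have hr0 : 0 < r := by linarith
  have hi1 : r⁻¹ ≤ 1 := inv_le_one_of_one_le₀ hr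
  have hi0 : 0 < r⁻¹ := inv_pos.2 hr0
  have hi2 : r⁻¹ ^ 2 ≤ 1 := pow_le_one₀ hi0.le hi1
  set w := a * r⁻¹ * x1 + q * x2 with hw
  have h1 := remF_lower (r⁻¹ * w) (r⁻¹ ^ 2) (by positivity) hi2
  have h2 : ε * remF (r⁻¹ * w) ≤ remF (r⁻¹ * w) := by
    have := remF_nonneg (r⁻¹ * w)
    nlinarith
  have h3 : ε * ((w ^ 2 - 1) / 12) ≤ r ^ 4 * remF (r⁻¹ * w) := by
    have h4 : r ^ 4 * ((r⁻¹ ^ 2 * (r⁻¹ * w) ^ 2 - (r⁻¹ ^ 2) ^ 2) / 12) = (w ^ 2 - 1) / 12 := by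
      field_simp
    have h5 := mul_le_mul_of_nonneg_left h1 (show 0 ≤ r ^ 4 by positivity)
    rw [h4] at h5
    calc ε * ((w ^ 2 - 1) / 12) ≤ ε * (r ^ 4 * remF (r⁻¹ * w)) :=
          mul_le_mul_of_nonneg_left h5 he0
      _ = r ^ 4 * (ε * remF (r⁻¹ * w)) := by ring
      _ ≤ _ := mul_le_mul_of_nonneg_left h2 (by positivity)
  refine le_trans ?_ h3
  have h6 : q ^ 2 * x2 ^ 2 / 2 - a ^ 2 * x1 ^ 2 ≤ w ^ 2 := by
    have h7 : (a * r⁻¹ * x1) ^ 2 ≤ a ^ 2 * x1 ^ 2 := by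
      have : 0 ≤ (a ^ 2 * x1 ^ 2) * (1 - r⁻¹ ^ 2) := mul_nonneg (by positivity) (by linarith)
      nlinarith
    have h8 := sq_nonneg (2 * (a * r⁻¹ * x1) + q * x2)
    rw [hw]
    nlinarith
  nlinarith

lemma laplace_core (α β lam a1 a2 q1 q2 : ℝ) (hα : 0 < α) (hβ : 0 < β) (hlam : 0 < lam)
    (hq1 : q1 ≠ 0) (G : ℝ → ℝ → ℝ)
    (hG : ∀ s t, G s t = lam / 2 * s ^ 2 + α * remF (a1 * s + q1 * t) + β * remF (a2 * s + q2 * t))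
    (ψ : BoundedContinuousFunction (ℝ × ℝ) ℝ) :
    Tendsto (fun N : ℕ => ∫ x : ℝ × ℝ,
        Real.exp (-(N : ℝ) * G (x.1 / (α * N) ^ ((1 : ℝ)/2)) (x.2 / (β * N) ^ ((1 : ℝ)/4))) * ψ x)
      atTop (𝓝 (∫ x : ℝ × ℝ, Real.exp (-(lam / (2 * α) * x.1 ^ 2
        + (α * q1 ^ 4 + β * q2 ^ 4) / (12 * β) * x.2 ^ 4)) * ψ x)) := by
  obtain ⟨A, hA, hA0⟩ : ∃ A : ℝ, A ^ 2 = α ∧ 0 < A := ⟨√α, Real.sq_sqrt hα.le, Real.sqrt_pos.2 hα⟩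
  set B : ℝ := β ^ ((1 : ℝ) / 4) with hBdef
  have hB : B ^ 4 = β := rpow_quarter_pow β hβ.le
  have hB0 : 0 < B := Real.rpow_pos_of_pos hβ _
  have hA' : α ^ ((1 : ℝ) / 2) = A := by
    rw [← Real.sqrt_eq_rpow, ← hA, Real.sqrt_sq hA0.le]
  set r : ℕ → ℝ := fun N => (N : ℝ) ^ ((1 : ℝ) / 4) with hrdef
  have hr4 : ∀ N : ℕ, r N ^ 4 = N := fun N => rpow_quarter_pow _ (Nat.cast_nonneg N)
  have hr1 : ∀ N : ℕ, 1 ≤ N → 1 ≤ r N := fun N hN =>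
    Real.one_le_rpow (by exact_mod_cast hN) (by norm_num)
  have hrt : Tendsto r atTop atTop :=
    (tendsto_rpow_atTop (by norm_num)).comp tendsto_natCast_atTop_atTop
  have hri : Tendsto (fun N => (r N)⁻¹) atTop (𝓝 0) := tendsto_inv_atTop_zero.comp hrt
  -- rewriting of the exponent
  have hexp : ∀ N : ℕ, 1 ≤ N → ∀ x : ℝ × ℝ,
      (N : ℝ) * G (x.1 / (α * N) ^ ((1 : ℝ)/2)) (x.2 / (β * N) ^ ((1 : ℝ)/4))
        = lam / (2 * α) * x.1 ^ 2
          + α * (r N ^ 4 * remF ((r N)⁻¹ * (a1 / A * (r N)⁻¹ * x.1 + q1 / B * x.2)))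
          + β * (r N ^ 4 * remF ((r N)⁻¹ * (a2 / A * (r N)⁻¹ * x.1 + q2 / B * x.2))) := by
    intro N hN x
    have hr0 : 0 < r N := by linarith [hr1 N hN]
    have e1 : (α * N) ^ ((1 : ℝ)/2) = A * r N ^ 2 := by
      rw [Real.mul_rpow hα.le (Nat.cast_nonneg N), hA', rpow_half_eq _ (Nat.cast_nonneg N)]
    have e2 : (β * N) ^ ((1 : ℝ)/4) = B * r N := by
      rw [Real.mul_rpow hβ.le (Nat.cast_nonneg N)]
    rw [e1, e2, hG, ← hr4 N]
    have e3 : ∀ a q : ℝ, a * (x.1 / (A * r N ^ 2)) + q * (x.2 / (B * r N))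
        = (r N)⁻¹ * (a / A * (r N)⁻¹ * x.1 + q / B * x.2) := by
      intro a q
      field_simp
    rw [e3, e3]
    have e4 : r N ^ 4 * (lam / 2 * (x.1 / (A * r N ^ 2)) ^ 2) = lam / (2 * α) * x.1 ^ 2 := by
      rw [← hA]
      field_simp
    rw [← e4]
    ring
  -- the constants of the dominating function
  set K : ℝ := α * (a1 / A) ^ 2 + β * (a2 / A) ^ 2 with hK
  have hK0 : 0 ≤ K := by positivity
  set m : ℝ := 3 * lam / α with hm
  have hm0 : 0 < m := by positivity
  set ε : ℝ := m / (m + K) with hε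
  have hε0 : 0 < ε := by positivity
  have hε1 : ε ≤ 1 := by
    rw [hε, div_le_one (by positivity)]
    linarith
  have hεK : ε * K ≤ m := by
    rw [hε, div_mul_eq_mul_div, div_le_iff₀ (by positivity)]
    nlinarith
  set c1 : ℝ := lam / (4 * α) with hc1
  have hc1p : 0 < c1 := by positivity
  set c2 : ℝ := ε / 24 * (α * (q1 / B) ^ 2 + β * (q2 / B) ^ 2) with hc2
  have hc2p : 0 < c2 := by positivity
  set C0 : ℝ := ε / 12 * (α + β) with hC0
  have hbound : ∀ N : ℕ, 1 ≤ N → ∀ x : ℝ × ℝ,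
      c1 * x.1 ^ 2 + c2 * x.2 ^ 2 - C0
        ≤ (N : ℝ) * G (x.1 / (α * N) ^ ((1 : ℝ)/2)) (x.2 / (β * N) ^ ((1 : ℝ)/4)) := by
    intro N hN x
    rw [hexp N hN x]
    have b1 := mul_le_mul_of_nonneg_left
      (remF_scaled_lower (r N) (a1 / A) (q1 / B) x.1 x.2 ε (hr1 N hN) hε0.le hε1) hα.le
    have b2 := mul_le_mul_of_nonneg_left
      (remF_scaled_lower (r N) (a2 / A) (q2 / B) x.1 x.2 ε (hr1 N hN) hε0.le hε1) hβ.le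
    have b3 : ε * K * x.1 ^ 2 ≤ m * x.1 ^ 2 := mul_le_mul_of_nonneg_right hεK (sq_nonneg _)
    have b4 : lam / (2 * α) * x.1 ^ 2 = c1 * x.1 ^ 2 + m * x.1 ^ 2 / 12 := by
      rw [hc1, hm]
      field_simp
      ring
    have b5 : c2 * x.2 ^ 2 - C0 - ε * K * x.1 ^ 2 / 12
        = α * (ε / 12 * ((q1 / B) ^ 2 * x.2 ^ 2 / 2 - (a1 / A) ^ 2 * x.1 ^ 2 - 1))
        + β * (ε / 12 * ((q2 / B) ^ 2 * x.2 ^ 2 / 2 - (a2 / A) ^ 2 * x.1 ^ 2 - 1)) := by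
      rw [hc2, hC0, hK]
      ring
    linarith
  have hGc : Continuous (fun p : ℝ × ℝ => G p.1 p.2) := by
    simp only [hG]
    have := continuous_remF
    fun_prop
  refine tendsto_integral_filter_of_dominated_convergence
    (fun x : ℝ × ℝ => Real.exp C0 * ‖ψ‖ * (Real.exp (-c1 * x.1 ^ 2) * Real.exp (-c2 * x.2 ^ 2)))
    ?_ ?_ ?_ ?_
  · refine Eventually.of_forall fun N => Continuous.aestronglyMeasurable ?_
    have h1 : Continuous (fun x : ℝ × ℝ =>
        G (x.1 / (α * N) ^ ((1 : ℝ)/2)) (x.2 / (β * N) ^ ((1 : ℝ)/4))) :=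
      hGc.comp (f := fun x : ℝ × ℝ =>
        (x.1 / (α * N) ^ ((1 : ℝ)/2), x.2 / (β * N) ^ ((1 : ℝ)/4))) (by fun_prop)
    exact (Real.continuous_exp.comp (continuous_const.mul h1)).mul ψ.continuous
  · filter_upwards [eventually_ge_atTop 1] with N hN
    refine Eventually.of_forall fun x => ?_
    rw [norm_mul, Real.norm_eq_abs (Real.exp _), abs_of_pos (Real.exp_pos _)]
    have h1 : Real.exp C0 * ‖ψ‖ * (Real.exp (-c1 * x.1 ^ 2) * Real.exp (-c2 * x.2 ^ 2))
        = Real.exp (C0 + (-c1 * x.1 ^ 2 + -c2 * x.2 ^ 2)) * ‖ψ‖ := by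
      rw [Real.exp_add, Real.exp_add]
      ring
    rw [h1]
    refine mul_le_mul (Real.exp_le_exp.2 ?_) (ψ.norm_coe_le_norm x) (norm_nonneg _)
      (Real.exp_pos _).le
    have := hbound N hN x
    linarith
  · exact ((integrable_exp_neg_mul_sq hc1p).mul_prod (integrable_exp_neg_mul_sq hc2p)).const_mul _
  · refine Eventually.of_forall fun x => ?_
    refine Tendsto.mul_const _ ?_
    refine (Real.continuous_exp.tendsto _).comp ?_
    have hone : ∀ᶠ N : ℕ in atTop, (N : ℝ) * (r N)⁻¹ ^ 4 = 1 := by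
      filter_upwards [eventually_ge_atTop 1] with N hN
      have hr0 : 0 < r N := by linarith [hr1 N hN]
      rw [← hr4 N]
      field_simp
    have l1 := remF_limit (a1 / A) (q1 / B) x.1 x.2 (fun N => (r N)⁻¹) (fun N => (r N)⁻¹)
      hone hri hri
    have l2 := remF_limit (a2 / A) (q2 / B) x.1 x.2 (fun N => (r N)⁻¹) (fun N => (r N)⁻¹)
      hone hri hri
    have l3 := (((l1.const_mul α).const_add (lam / (2 * α) * x.1 ^ 2)).add (l2.const_mul β)).neg
    have e5 : lam / (2 * α) * x.1 ^ 2 + α * ((q1 / B * x.2) ^ 4 / 12)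
        + β * ((q2 / B * x.2) ^ 4 / 12)
        = lam / (2 * α) * x.1 ^ 2 + (α * q1 ^ 4 + β * q2 ^ 4) / (12 * β) * x.2 ^ 4 := by
      have : (α * q1 ^ 4 + β * q2 ^ 4) / (12 * β) = (α * q1 ^ 4 + β * q2 ^ 4) / (12 * B ^ 4) := by
        rw [hB]
      rw [this]
      field_simp
      ring
    rw [e5] at l3
    refine l3.congr' ?_
    filter_upwards [eventually_ge_atTop 1] with N hN
    rw [neg_mul, hexp N hN x, hr4 N]

lemma Gtil_form (α J11 J12 J22 : ℝ) (hα0 : 0 < α) (hα1 : α < 1) (hJ12 : J12 ≠ 0)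
    (hC2 : J11 < 1 / α) (hC3 : J22 < 1 / (1 - α))
    (hC4 : (1 - α * J11) * (1 - (1 - α) * J22) = α * (1 - α) * J12 ^ 2)
    (hC5 : 1 < α * J11 + (1 - α) * J22) :
    0 < lamM α J11 J12 J22 ∧ ∃ a1 a2 q1 q2 : ℝ, q1 ≠ 0 ∧
      (α * q1 ^ 4 + (1 - α) * q2 ^ 4) / (12 * (1 - α)) = zeta2 α J11 J12 J22 ∧
      ∀ s t, Gtil α J11 J12 J22 s t = lamM α J11 J12 J22 / 2 * s ^ 2
        + α * remF (a1 * s + q1 * t) + (1 - α) * remF (a2 * s + q2 * t) := by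
  obtain ⟨β, hβ⟩ : ∃ β, β = 1 - α := ⟨_, rfl⟩
  have hβ0 : 0 < β := by linarith
  obtain ⟨a, ha⟩ : ∃ a, a = 1 - α * J11 := ⟨_, rfl⟩
  obtain ⟨b, hb⟩ : ∃ b, b = 1 - β * J22 := ⟨_, rfl⟩
  have ha0 : 0 < a := by
    rw [lt_div_iff₀ hα0] at hC2
    linarith
  have hb0 : 0 < b := by
    rw [← hβ, lt_div_iff₀ hβ0] at hC3
    linarith
  rw [← hβ, ← ha, ← hb] at hC4
  obtain ⟨k, hk⟩ : ∃ k, k = 1 - a - b := ⟨_, rfl⟩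
  have hk0 : 0 < k := by
    rw [← hβ] at hC5
    linarith
  have H11 : Hess11 α J11 J12 J22 = α * a * k := by
    have e : α * J11 = 1 - a := by linarith
    unfold Hess11
    rw [← hβ, ← ha, hk]
    linear_combination (α * a) * e + α * hC4
  have H22 : Hess22 α J11 J12 J22 = β * b * k := by
    have e : β * J22 = 1 - b := by linarith
    unfold Hess22
    rw [← hβ, ← hb, hk]
    linear_combination (β * b) * e + β * hC4
  have H12 : Hess12 α J11 J12 J22 = -(α * β * J12 * k) := by
    have e : β * J22 = 1 - b := by linarith
    unfold Hess12
    rw [← hβ, ← ha, hk, e]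
    ring
  obtain ⟨S, hS⟩ : ∃ S, S = α * a + β * b := ⟨_, rfl⟩
  have hS0 : 0 < S := by rw [hS]; positivity
  have hsq : Real.sqrt ((Hess11 α J11 J12 J22 - Hess22 α J11 J12 J22)^2
      + 4 * (Hess12 α J11 J12 J22)^2) = k * S := by
    rw [H11, H22, H12]
    rw [show (α * a * k - β * b * k) ^ 2 + 4 * (-(α * β * J12 * k)) ^ 2 = (k * S) ^ 2 by
      rw [hS]; linear_combination (-4 * α * β * k ^ 2) * hC4]
    exact Real.sqrt_sq (by positivity)
  have hM : lamM α J11 J12 J22 = k * S := by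
    unfold lamM
    rw [hsq, H11, H22, hS]; ring
  have hm : lamm α J11 J12 J22 = 0 := by
    unfold lamm
    rw [hsq, H11, H22, hS]; ring
  -- eigenvectors
  obtain ⟨c, hc⟩ : ∃ c, c = -(b / (α * J12)) := ⟨_, rfl⟩
  obtain ⟨d, hd⟩ : ∃ d, d = a / (β * J12) := ⟨_, rfl⟩
  have hvM : vM α J11 J12 J22 = ![1, c] := by
    unfold vM
    rw [hM, H11, H12, hS, hc]
    congr 2
    field_simp
    ring
  have hvm : vm α J11 J12 J22 = ![1, d] := by
    unfold vm
    rw [hm, H11, H12, hd]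
    congr 2
    field_simp
    ring
  have hcd : 1 + c * d = 0 := by
    rw [hc, hd]
    field_simp
    linear_combination -hC4
  obtain ⟨n, hn⟩ : ∃ n, n = Real.sqrt (1 + c ^ 2) := ⟨_, rfl⟩
  obtain ⟨l, hl⟩ : ∃ l, l = Real.sqrt (1 + d ^ 2) := ⟨_, rfl⟩
  have hn0 : 0 < n := by rw [hn]; positivity
  have hl0 : 0 < l := by rw [hl]; positivity
  have hn2 : n ^ 2 = 1 + c ^ 2 := by rw [hn, Real.sq_sqrt (by positivity)]
  have hl2 : l ^ 2 = 1 + d ^ 2 := by rw [hl, Real.sq_sqrt (by positivity)]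
  have hP : (Pmat α J11 J12 J22)⁻¹ = !![n⁻¹, l⁻¹; n⁻¹ * c, l⁻¹ * d] := by
    apply Matrix.inv_eq_right_inv
    have e1 : vnorm ![1, c] = n := by simp [vnorm, hn]
    have e2 : vnorm ![1, d] = l := by simp [vnorm, hl]
    unfold Pmat
    rw [hvM, hvm, e1, e2]
    ext i j
    fin_cases i <;> fin_cases j <;> simp [Matrix.mul_apply, Fin.sum_univ_two]
    · field_simp
      linarith
    · field_simp
      linear_combination hcd
    · field_simp
      linear_combination hcd
    · field_simp
      linarith
  -- kernel relations
  have hd2 : d ^ 2 = α * a / (β * b) := by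
    rw [hd]
    field_simp
    linear_combination hC4
  have hk1 : α * J11 + β * J12 * d = 1 := by
    rw [hd]
    field_simp
    linarith
  have hk2 : α * J12 + β * J22 * d = d := by
    have e : β * J22 = 1 - b := by linarith
    rw [e, hd]
    field_simp
    linear_combination -hC4
  refine ⟨by rw [hM]; positivity, n⁻¹ * (α * J11 + β * J12 * c), n⁻¹ * (α * J12 + β * J22 * c),
    l⁻¹, l⁻¹ * d, by positivity, ?_, ?_⟩
  · have hl4 : l ^ 2 = S / (β * b) := by
      rw [hl2, hd2, hS]
      field_simp
      ring
    unfold zeta2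
    rw [← hβ, ← ha, ← hb, ← hS]
    rw [show (l⁻¹) ^ 4 = ((l ^ 2) ^ 2)⁻¹ by field_simp,
      show (l⁻¹ * d) ^ 4 = ((l ^ 2) ^ 2)⁻¹ * (d ^ 2) ^ 2 by field_simp, hl4, hd2]
    field_simp
    ring
  · intro s t
    unfold Gtil
    rw [hP]
    simp only [Matrix.mulVec, dotProduct, Fin.sum_univ_two, Matrix.of_apply, Matrix.cons_val_zero,
      Matrix.cons_val_one, Matrix.cons_val', Matrix.cons_val_fin_one]
    obtain ⟨X, hX⟩ : ∃ X, X = n⁻¹ * s + l⁻¹ * t := ⟨_, rfl⟩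
    obtain ⟨Y, hY⟩ : ∃ Y, Y = n⁻¹ * c * s + l⁻¹ * d * t := ⟨_, rfl⟩
    rw [← hX, ← hY]
    have y1 : n⁻¹ * (α * J11 + β * J12 * c) * s + l⁻¹ * t = α * J11 * X + β * J12 * Y := by
      rw [hX, hY]
      linear_combination (-(l⁻¹ * t)) * hk1
    have y2 : n⁻¹ * (α * J12 + β * J22 * c) * s + l⁻¹ * d * t = α * J12 * X + β * J22 * Y := by
      rw [hX, hY]
      linear_combination (-(l⁻¹ * t)) * hk2
    rw [y1, y2, hM]
    unfold presG remF
    rw [← hβ]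
    have quad : Hess11 α J11 J12 J22 * X ^ 2 + 2 * Hess12 α J11 J12 J22 * X * Y
        + Hess22 α J11 J12 J22 * Y ^ 2 = k * S * s ^ 2 := by
      have i2 : n⁻¹ ^ 2 * (1 + c ^ 2) = 1 := by rw [← hn2]; field_simp
      have w : d * X - Y = n⁻¹ * (d - c) * s := by rw [hX, hY]; ring
      have f1 : α * a = β * b * d ^ 2 := by rw [hd2]; field_simp
      have f2 : α * β * J12 = β * b * d := by
        rw [hd]
        field_simp
        linear_combination -hC4
      have f3 : S = β * b * (1 + d ^ 2) := by rw [hS, f1]; ring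
      have f4 : (d - c) ^ 2 = (1 + c ^ 2) * (1 + d ^ 2) := by
        linear_combination (-(1 + c * d)) * hcd
      rw [H11, H12, H22, f1, f2, f3]
      calc _ = k * β * b * (d * X - Y) ^ 2 := by ring
        _ = k * β * b * (n⁻¹ ^ 2 * (d - c) ^ 2) * s ^ 2 := by rw [w]; ring
        _ = k * β * b * ((n⁻¹ ^ 2 * (1 + c ^ 2)) * (1 + d ^ 2)) * s ^ 2 := by rw [f4]; ring
        _ = _ := by rw [i2]; ring
    unfold Hess11 Hess12 Hess22 at quad
    rw [← hβ] at quad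
    linear_combination (1 / 2) * quad

/-- Convergence of normalized Laplace integrals: for every bounded continuous `ψ`, the
ratio of `∬ exp(-N G̃(x1/N1^{1/2}, x2/N2^{1/4})) ψ`
to `∬ exp(-N G̃(x1/N1^{1/2}, x2/N2^{1/4}))` converges, as `N → ∞` along integers with
`αN ∈ ℕ`, to the corresponding ratio for the density `exp(-ζ1 x1² - ζ2 x2⁴)`. -/
theorem laplace_ratio_convergence
    (α J11 J12 J22 : ℝ) (hα0 : 0 < α) (hα1 : α < 1)
    (hJ11 : 0 < J11) (hJ22 : 0 < J22) (hJ12 : J12 ≠ 0)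
    (hC2 : J11 < 1 / α) (hC3 : J22 < 1 / (1 - α))
    (hC4 : (1 - α * J11) * (1 - (1 - α) * J22) = α * (1 - α) * J12 ^ 2)
    (hC5 : 1 < α * J11 + (1 - α) * J22)
    (hpd : (Jmat J11 J12 J22).PosDef) :
    ∀ ψ : BoundedContinuousFunction (ℝ × ℝ) ℝ,
      Tendsto
        (fun N : ℕ =>
          (∫ x : ℝ × ℝ,
            Real.exp (-(N : ℝ) * Gtil α J11 J12 J22
              (x.1 / (α * N) ^ ((1 : ℝ)/2)) (x.2 / ((1 - α) * N) ^ ((1 : ℝ)/4))) * ψ x) /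
          (∫ x : ℝ × ℝ,
            Real.exp (-(N : ℝ) * Gtil α J11 J12 J22
              (x.1 / (α * N) ^ ((1 : ℝ)/2)) (x.2 / ((1 - α) * N) ^ ((1 : ℝ)/4)))))
        (atTop ⊓ Filter.principal {N : ℕ | ∃ m : ℕ, (m : ℝ) = α * N})
        (𝓝 ((∫ x : ℝ × ℝ,
            Real.exp (-(zeta1 α J11 J12 J22 * x.1 ^ 2 + zeta2 α J11 J12 J22 * x.2 ^ 4)) * ψ x) /
          (∫ x : ℝ × ℝ,
            Real.exp (-(zeta1 α J11 J12 J22 * x.1 ^ 2 + zeta2 α J11 J12 J22 * x.2 ^ 4))))) := by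
  intro ψ
  obtain ⟨hlam, a1, a2, q1, q2, hq1, hz, hG⟩ :=
    Gtil_form α J11 J12 J22 hα0 hα1 hJ12 hC2 hC3 hC4 hC5
  have core := fun φ => laplace_core α (1 - α) (lamM α J11 J12 J22) a1 a2 q1 q2 hα0
    (by linarith) hlam hq1 (Gtil α J11 J12 J22) hG φ
  rw [hz] at core
  have hz1 : lamM α J11 J12 J22 / (2 * α) = zeta1 α J11 J12 J22 := rfl
  rw [hz1] at core
  have hden := core 1
  simp only [BoundedContinuousFunction.coe_one, Pi.one_apply, mul_one] at hden
  refine Tendsto.mono_left (Tendsto.div (core ψ) hden ?_) inf_le_left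
  have hz1p : 0 < zeta1 α J11 J12 J22 := by
    rw [← hz1]
    positivity
  have hz2p : 0 < zeta2 α J11 J12 J22 := by
    rw [← hz]
    have : 0 < 1 - α := by linarith
    positivity
  refine (integral_exp_pos ?_).ne'
  have hI := ((integrable_exp_neg_mul_sq hz1p).mul_prod
    (integrable_exp_neg_mul_sq hz2p)).const_mul (Real.exp (zeta2 α J11 J12 J22))
  refine hI.mono' (Continuous.aestronglyMeasurable (by fun_prop)) (Eventually.of_forall fun x => ?_)
  rw [Real.norm_eq_abs, abs_of_pos (Real.exp_pos _), ← Real.exp_add, ← Real.exp_add]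
  refine Real.exp_le_exp.2 ?_
  have h1 : x.2 ^ 2 - 1 ≤ x.2 ^ 4 := by nlinarith [sq_nonneg (x.2 ^ 2 - 1), sq_nonneg x.2]
  nlinarith

end
end

section
/- Assume α ∈ (0,1), J11 > 0, J22 > 0, J12 ≠ 0 satisfy conditions (C) and the matrix J = (J11, J12; J12, J22) is positive definite. Let J̃ = P⁻¹A²JA²P with A = diag(√α, √(1−α)), with entries J̃11, J̃12, J̃22. Then the constant d := α/λ_M − α·J̃22/(J̃11·J̃22 − J̃12²) is strictly positive. -/
noncomputable section
open Real Matrix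

/-- Entries of `Pᵀ K P` type conjugation, in terms of an orthogonal `P`. -/
lemma Jtil_entries (α J11 J12 J22 p q r w : ℝ)
    (hP : Pmat α J11 J12 J22 = !![p, q; r, w])
    (h1 : p^2 + q^2 = 1) (h2 : r^2 + w^2 = 1) (h3 : p*r + q*w = 0) :
    Jtil α J11 J12 J22 1 1 =
      q^2 * (α^2*J11) + 2*q*w*(α*(1-α)*J12) + w^2*((1-α)^2*J22) ∧
    Jtil α J11 J12 J22 0 0 * Jtil α J11 J12 J22 1 1 - (Jtil α J11 J12 J22 0 1)^2 =
      α^2*(1-α)^2*(J11*J22-J12^2) := by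
  have hinv : (!![p, q; r, w] : Matrix (Fin 2) (Fin 2) ℝ)⁻¹ = !![p, r; q, w] := by
    apply Matrix.inv_eq_right_inv
    ext i j
    fin_cases i <;> fin_cases j <;> simp [Matrix.mul_apply, Fin.sum_univ_two] <;> linarith
  have hd : (p*w-q*r)^2 = 1 := by
    linear_combination (r^2+w^2)*h1 + h2 - (p*r+q*w)*h3
  have e : Jtil α J11 J12 J22 = !![p, r; q, w] * Asq α * Jmat J11 J12 J22 * Asq α
      * !![p, q; r, w] := by
    rw [Jtil, hP, hinv]
  have hA : Asq α = !![α, 0; 0, 1 - α] := by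
    ext i j
    fin_cases i <;> fin_cases j <;> simp [Asq]
  have e11 : Jtil α J11 J12 J22 1 1 =
      q^2 * (α^2*J11) + 2*q*w*(α*(1-α)*J12) + w^2*((1-α)^2*J22) := by
    rw [e, hA]; simp [Matrix.mul_apply, Fin.sum_univ_two, Jmat]; ring
  have e00 : Jtil α J11 J12 J22 0 0 =
      p^2 * (α^2*J11) + 2*p*r*(α*(1-α)*J12) + r^2*((1-α)^2*J22) := by
    rw [e, hA]; simp [Matrix.mul_apply, Fin.sum_univ_two, Jmat]; ring
  have e01 : Jtil α J11 J12 J22 0 1 =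
      p*q * (α^2*J11) + (p*w+q*r)*(α*(1-α)*J12) + r*w*((1-α)^2*J22) := by
    rw [e, hA]; simp [Matrix.mul_apply, Fin.sum_univ_two, Jmat]; ring
  refine ⟨e11, ?_⟩
  rw [e00, e11, e01]
  linear_combination (α^2*(1-α)^2*(J11*J22-J12^2)) * hd

set_option maxHeartbeats 2000000 in
/-- Under conditions (C) and positive definiteness of `J`, the constant
`d = α/λ_M - α J̃22/(J̃11 J̃22 - J̃12²)` is strictly positive. -/
theorem variance_constant_pos
    (α J11 J12 J22 : ℝ) (hα0 : 0 < α) (hα1 : α < 1)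
    (hJ11 : 0 < J11) (hJ22 : 0 < J22) (hJ12 : J12 ≠ 0)
    (hC2 : J11 < 1 / α) (hC3 : J22 < 1 / (1 - α))
    (hC4 : (1 - α * J11) * (1 - (1 - α) * J22) = α * (1 - α) * J12 ^ 2)
    (hC5 : 1 < α * J11 + (1 - α) * J22)
    (hpd : (Jmat J11 J12 J22).PosDef) :
    0 < α / lamM α J11 J12 J22 -
        α * Jtil α J11 J12 J22 1 1 /
          (Jtil α J11 J12 J22 0 0 * Jtil α J11 J12 J22 1 1 -
            (Jtil α J11 J12 J22 0 1) ^ 2) := by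
  have hβ : 0 < 1 - α := by linarith
  have ha : 0 < 1 - α * J11 := by
    rw [lt_div_iff₀ hα0] at hC2; linarith
  have hb : 0 < 1 - (1 - α) * J22 := by
    rw [lt_div_iff₀ hβ] at hC3; linarith
  obtain ⟨t, ht⟩ : ∃ t, t = α * J11 + (1 - α) * J22 - 1 := ⟨_, rfl⟩
  have htpos : 0 < t := by linarith
  have H11 : Hess11 α J11 J12 J22 = α * (1 - α * J11) * t := by
    rw [Hess11, ht]; linear_combination α * hC4
  have H22 : Hess22 α J11 J12 J22 = (1 - α) * (1 - (1 - α) * J22) * t := by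
    rw [Hess22, ht]; linear_combination (1 - α) * hC4
  have H12 : Hess12 α J11 J12 J22 = - (α * (1 - α) * J12 * t) := by
    rw [Hess12, ht]; ring
  have hsq : Real.sqrt ((Hess11 α J11 J12 J22 - Hess22 α J11 J12 J22)^2
      + 4 * (Hess12 α J11 J12 J22)^2) = Hess11 α J11 J12 J22 + Hess22 α J11 J12 J22 := by
    rw [show (Hess11 α J11 J12 J22 - Hess22 α J11 J12 J22)^2
      + 4 * (Hess12 α J11 J12 J22)^2 = (Hess11 α J11 J12 J22 + Hess22 α J11 J12 J22)^2 by
        rw [H11, H22, H12]; linear_combination (-4*α*(1-α)*t^2) * hC4]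
    apply Real.sqrt_sq
    rw [H11, H22]; positivity
  have hM : lamM α J11 J12 J22 = Hess11 α J11 J12 J22 + Hess22 α J11 J12 J22 := by
    rw [lamM, hsq]; ring
  have hm : lamm α J11 J12 J22 = 0 := by
    rw [lamm, hsq]; ring
  obtain ⟨s, hs⟩ : ∃ s, s = -((1 - (1 - α) * J22) / (α * J12)) := ⟨_, rfl⟩
  have hs0 : s ≠ 0 := by
    rw [hs]; exact neg_ne_zero.mpr (div_ne_zero hb.ne' (mul_ne_zero hα0.ne' hJ12))
  have hsJ : s * (α * J12) = -(1 - (1 - α) * J22) := by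
    rw [hs]; field_simp
  have hs2 : s^2 * (α * (1 - α * J11)) = (1 - α) * (1 - (1 - α) * J22) := by
    have h : (s^2 * (α * (1 - α * J11)) - (1 - α) * (1 - (1 - α) * J22))
      * (1 - (1 - α) * J22) = 0 := by
      linear_combination α * s^2 * hC4
        + (1-α) * (s * (α * J12) - (1 - (1 - α) * J22)) * hsJ
    rcases mul_eq_zero.mp h with h | h
    · linarith
    · exact absurd h hb.ne'
  have hsa : s * (1 - α * J11) = -((1 - α) * J12) := by
    apply mul_right_cancel₀ (mul_ne_zero hα0.ne' hJ12)
    linear_combination (1 - α * J11) * hsJ - hC4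
  have hvM : vM α J11 J12 J22 = ![1, s] := by
    rw [vM, hM, add_sub_cancel_left, H22, H12]
    congr 2
    rw [hs]; field_simp
  have hvm : vm α J11 J12 J22 = ![1, -s⁻¹] := by
    rw [vm, hm, H11, H12]
    congr 2
    rw [eq_neg_iff_add_eq_zero]
    field_simp
    linear_combination (α * t) * hsa
  obtain ⟨n, hn⟩ : ∃ n, n = (Real.sqrt (1 + s^2))⁻¹ := ⟨_, rfl⟩
  obtain ⟨m, hmm⟩ : ∃ m, m = (Real.sqrt (1 + (s⁻¹)^2))⁻¹ := ⟨_, rfl⟩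
  have hn2 : n^2 * (1 + s^2) = 1 := by
    rw [hn, inv_pow, Real.sq_sqrt (by positivity)]
    exact inv_mul_cancel₀ (by positivity)
  have hm2' : m^2 * (1 + (s⁻¹)^2) = 1 := by
    rw [hmm, inv_pow, Real.sq_sqrt (by positivity)]
    exact inv_mul_cancel₀ (by positivity)
  have hsi : s * s⁻¹ = 1 := mul_inv_cancel₀ hs0
  have hP : Pmat α J11 J12 J22 = !![n, n*s; m, m * (-s⁻¹)] := by
    rw [Pmat, hvM, hvm]
    ext i j
    fin_cases i <;> fin_cases j <;> simp [vnorm, hn, hmm]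
  obtain ⟨e11, edet⟩ := Jtil_entries α J11 J12 J22 n (n*s) m (m * (-s⁻¹)) hP
    (by linear_combination hn2) (by linear_combination hm2')
    (by linear_combination (-n*m) * hsi)
  have hw2 : (m * (-s⁻¹))^2 = n^2 := by
    have h : ((m * (-s⁻¹))^2 - n^2) * (1 + s^2) = 0 := by
      linear_combination hm2' - hn2 + m^2 * (s * s⁻¹ + 1) * hsi
    rcases mul_eq_zero.mp h with h | h
    · linarith
    · exact absurd h (by positivity)
  obtain ⟨w, hw⟩ : ∃ w, w = m * (-s⁻¹) := ⟨_, rfl⟩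
  rw [← hw] at hw2 e11
  have hsJneg : s * J12 < 0 := by
    by_contra hcon
    push Not at hcon
    have : 0 ≤ α * (s * J12) := by positivity
    linarith
  have hnn : 0 < n := by rw [hn]; positivity
  have hcross : n * s * w * J12 ≤ - (n^2 * (s * J12)) := by
    rcases sq_eq_sq_iff_eq_or_eq_neg.mp hw2 with h | h
    · have : 0 < n^2 * (-(s*J12)) := mul_pos (by positivity) (by linarith)
      rw [h]; linarith
    · rw [h]; apply le_of_eq; ring
  have hdet : α^2*(1-α)^2*(J11*J22-J12^2) = α*(1-α)*t := by
    rw [ht]; linear_combination α*(1-α)*hC4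
  rw [edet, hdet, e11, hM, H11, H22]
  have hl : 0 < α * (1 - α * J11) * t + (1 - α) * (1 - (1 - α) * J22) * t := by positivity
  have hD : 0 < α * (1-α) * t := by positivity
  rw [sub_pos, div_lt_div_iff₀ hD hl, mul_assoc]
  apply mul_lt_mul_of_pos_left _ hα0
  have hup : (n*s)^2 * (α^2*J11) + 2*(n*s)*w*(α*(1-α)*J12) + w^2*((1-α)^2*J22) ≤
      n^2 * (s^2 * (α^2*J11) + 2 * ((1-α) * (1 - (1-α)*J22)) + (1-α)^2*J22) := by
    have := mul_le_mul_of_nonneg_left hcross (by positivity : 0 ≤ 2 * (α * (1-α)))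
    rw [hw2]
    linear_combination this - 2 * n^2 * (1-α) * hsJ
  refine lt_of_le_of_lt (mul_le_mul_of_nonneg_right hup hl.le) ?_
  have hA : α * (1 - α * J11) * t + (1 - α) * (1 - (1 - α) * J22) * t
      = α * (1 - α * J11) * t * (1 + s^2) := by
    linear_combination (-t) * hs2
  have hfin : n^2 * (s^2 * (α^2*J11) + 2 * ((1-α) * (1 - (1-α)*J22)) + (1-α)^2*J22)
      * (α * (1 - α * J11) * t + (1 - α) * (1 - (1 - α) * J22) * t)
      = α * (1-α) * t * (1 - t) := by
    rw [hA]
    have h4 : (s^2 * (α^2*J11) + 2 * ((1-α) * (1 - (1-α)*J22)) + (1-α)^2*J22)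
        * (1 - α * J11) = (1-α) * (1 - t) := by
      rw [ht]; linear_combination α * J11 * hs2
    linear_combination (α * t * (1-α) * (1-t)) * hn2 + (n^2 * (1+s^2) * α * t) * h4
  rw [hfin]
  nlinarith [mul_pos hD htpos]

end
end
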